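/- Let 1 ≤ d ≤ n be integers, H ⊂ ℝ^n closed, P(H) a good class with finite Plateau infimum, and let μ be a weak-* limit in ℝ^n ∖ H of the measures μ_j = H^d ⌐ K_j along a minimizing sequence (K_j) ⊂ P(H). Then there exists a constant θ_0 = θ_0(n,d) > 0, depending only on n and d, such that μ(B_{x,r}) ≥ θ_0 ω_d r^d for every x ∈ spt μ and every r < dist(x,H), where ω_d is the Lebesgue measure of the unit ball of ℝ^d. -/

import Mathlib

open MeasureTheory Metric Filter Set
open scoped ENNReal NNReal Topology RealInnerProductSpace

noncomputable section

/-- Euclidean space `ℝ^n`. -/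
abbrev Euc (n : ℕ) : Type := EuclideanSpace ℝ (Fin n)

/-- A set is countably `H^d`-rectifiable if, up to an `H^d`-negligible set, it can be
covered by countably many images of `C^1` maps from `ℝ^d`. -/
def CountablyRectifiable (d : ℕ) {n : ℕ} (K : Set (Euc n)) : Prop :=
  ∃ f : ℕ → (Euc d → Euc n), (∀ i, ContDiff ℝ 1 (f i)) ∧
    μH[(d : ℝ)] (K \ ⋃ i, Set.range (f i)) = 0

/-- A smooth diffeomorphism of `ℝ^n`. -/
def IsDiffeo {n : ℕ} (f : Euc n → Euc n) : Prop :=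
  ContDiff ℝ (⊤ : ℕ∞) f ∧ ∃ g : Euc n → Euc n, ContDiff ℝ (⊤ : ℕ∞) g ∧
    Function.LeftInverse g f ∧ Function.RightInverse g f

/-- The class `𝔇(x,r)`: maps equal to the identity outside `B(x,r)` which are smoothly
isotopic to the identity inside `B(x,r)`. -/
def IsotopyClass {n : ℕ} (x : Euc n) (r : ℝ) : Set (Euc n → Euc n) :=
  {φ | (∀ z ∉ ball x r, φ z = z) ∧
    ∃ lam : ℝ → Euc n → Euc n,
      ContDiff ℝ (⊤ : ℕ∞) (fun p : ℝ × Euc n => lam p.1 p.2) ∧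
      lam 0 = id ∧ lam 1 = φ ∧
      (∀ t ∈ Icc (0 : ℝ) 1, ∀ z ∉ ball x r, lam t z = z) ∧
      (∀ t ∈ Icc (0 : ℝ) 1, IsDiffeo (lam t))}

/-- The class `D(x,r)`: Lipschitz maps in the `C^0`-closure of `𝔇(x,r)`. -/
def DeformClass {n : ℕ} (x : Euc n) (r : ℝ) : Set (Euc n → Euc n) :=
  {φ | (∃ C : ℝ≥0, LipschitzWith C φ) ∧
    ∃ ψ : ℕ → (Euc n → Euc n), (∀ j, ψ j ∈ IsotopyClass x r) ∧
      TendstoUniformly ψ φ atTop}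

/-- `K` is relatively closed in `U`. -/
def RelClosedIn {n : ℕ} (U K : Set (Euc n)) : Prop :=
  K ⊆ U ∧ ∃ F : Set (Euc n), IsClosed F ∧ K = F ∩ U

/-- `inf { H^d(J) : J ∈ P, J ∖ cl B(x,r) = K ∖ cl B(x,r) }`. -/
def competInf (d : ℕ) {n : ℕ} (P : Set (Set (Euc n))) (K : Set (Euc n)) (x : Euc n)
    (r : ℝ) : ℝ≥0∞ :=
  sInf {m | ∃ J ∈ P, J \ closure (ball x r) = K \ closure (ball x r) ∧ m = μH[(d : ℝ)] J}

/-- A family `P` is a good class (for boundary `H`). -/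
def IsGoodClass (d : ℕ) {n : ℕ} (H : Set (Euc n)) (P : Set (Set (Euc n))) : Prop :=
  ∀ K ∈ P, ∀ x ∈ K, ∀ᵐ r ∂(volume : Measure ℝ),
    (0 < r ∧ ENNReal.ofReal r < EMetric.infEdist x H) →
      ∀ φ ∈ DeformClass x r, competInf d P K x r ≤ μH[(d : ℝ)] (φ '' K)

/-- The Plateau infimum `m₀ = inf {H^d(K) : K ∈ P}`. -/
def plateauInf (d : ℕ) {n : ℕ} (P : Set (Set (Euc n))) : ℝ≥0∞ := ⨅ K ∈ P, μH[(d : ℝ)] K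

/-- A minimizing sequence: `H^d(K_j) ↓ m₀`. -/
def IsMinimizingSeq (d : ℕ) {n : ℕ} (P : Set (Set (Euc n))) (Kj : ℕ → Set (Euc n)) : Prop :=
  (∀ j, Kj j ∈ P) ∧ Antitone (fun j => μH[(d : ℝ)] (Kj j)) ∧
    Tendsto (fun j => μH[(d : ℝ)] (Kj j)) atTop (𝓝 (plateauInf d P))

/-- The support of a measure. -/
def sptMeas {n : ℕ} (μ : Measure (Euc n)) : Set (Euc n) :=
  {x | ∀ r : ℝ, 0 < r → 0 < μ (ball x r)}

/-- Weak-* convergence of measures in the open set `U`. -/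
def WeakStarOn {n : ℕ} (U : Set (Euc n)) (μs : ℕ → Measure (Euc n)) (μ : Measure (Euc n)) :
    Prop :=
  ∀ f : Euc n → ℝ, Continuous f → HasCompactSupport f → tsupport f ⊆ U →
    Tendsto (fun j => ∫ z, f z ∂(μs j)) atTop (𝓝 (∫ z, f z ∂μ))

/-- The (multiplicity one) varifold associated to `K` is stationary in `U`: the first
variation of `H^d ⌐ K` along any compactly supported `C^1` vector field in `U` vanishes. -/
def StationaryIn (d : ℕ) {n : ℕ} (K U : Set (Euc n)) : Prop :=
  ∀ X : Euc n → Euc n, ContDiff ℝ 1 X → HasCompactSupport X → tsupport X ⊆ U →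
    HasDerivAt (fun t : ℝ => (μH[(d : ℝ)] ((fun z => z + t • X z) '' K)).toReal) 0 0

/-- `S` is a `d`-dimensional real analytic submanifold of `ℝ^n`. -/
def IsAnalyticSubmanifold (d : ℕ) {n : ℕ} (S : Set (Euc n)) : Prop :=
  ∀ x ∈ S, ∃ (U : Set (Euc n)) (V : Set (Euc d)) (f : Euc d → Euc n),
    IsOpen U ∧ x ∈ U ∧ IsOpen V ∧ AnalyticOnNhd ℝ f V ∧ Set.InjOn f V ∧
    (∀ y ∈ V, Function.Injective (fderiv ℝ f y)) ∧ f '' V = S ∩ U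

/-- `ω_d`, the Lebesgue measure of the unit ball of `ℝ^d`. -/
def ballVol (d : ℕ) : ℝ≥0∞ := volume (ball (0 : Euc d) 1)

/-- The `d`-dimensional density of `μ` at `x` is `θ`. -/
def HasDensityAt (d : ℕ) {n : ℕ} (μ : Measure (Euc n)) (x : Euc n) (θ : ℝ≥0∞) : Prop :=
  Tendsto (fun r : ℝ => μ (ball x r) / (ballVol d * ENNReal.ofReal r ^ d)) (𝓝[>] 0) (𝓝 θ)

/-- The blow-up `(K - x)/r`. -/
def blowup {n : ℕ} (x : Euc n) (r : ℝ) (K : Set (Euc n)) : Set (Euc n) :=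
  (fun y => r⁻¹ • (y - x)) '' K

/-- `π` is the approximate tangent plane of `K` at `x`: `π` is a `d`-dimensional subspace and
`H^d ⌐ (K-x)/r` converges weakly-* to `H^d ⌐ π` as `r → 0⁺`. -/
def HasApproxTangentPlane (d : ℕ) {n : ℕ} (K : Set (Euc n)) (x : Euc n) (π : Set (Euc n)) :
    Prop :=
  (∃ W : Submodule ℝ (Euc n), Module.finrank ℝ W = d ∧ π = (W : Set (Euc n))) ∧
  ∀ f : Euc n → ℝ, Continuous f → HasCompactSupport f →
    Tendsto (fun r : ℝ => ∫ z, f z ∂(μH[(d : ℝ)].restrict (blowup x r K))) (𝓝[>] 0)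
      (𝓝 (∫ z, f z ∂(μH[(d : ℝ)].restrict π)))

/-- The sphere `S^m`, realized as the unit sphere of `ℝ^{m+1}`. -/
def sph (m : ℕ) : Set (Euc (m + 1)) := sphere 0 1

/-- A smooth embedding of `S^{n-d}` into `ℝ^n ∖ H` (given by a smooth ambient map which is
injective and immersive on the sphere, with image avoiding `H`). -/
def IsEmbeddedSphere (n d : ℕ) (H : Set (Euc n)) (γ : Euc (n - d + 1) → Euc n) : Prop :=
  ContDiff ℝ (⊤ : ℕ∞) γ ∧ Set.InjOn γ (sph (n - d)) ∧
  (∀ y ∈ sph (n - d), ∀ v : Euc (n - d + 1), ⟪v, y⟫ = (0 : ℝ) → fderiv ℝ γ y v = 0 → v = 0) ∧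
  γ '' sph (n - d) ⊆ Hᶜ

/-- `γ` and `γ'` are smoothly isotopic embeddings of `S^{n-d}` in `ℝ^n ∖ H`. -/
def SphereIsotopic (n d : ℕ) (H : Set (Euc n)) (γ γ' : Euc (n - d + 1) → Euc n) : Prop :=
  ∃ Γ : ℝ → Euc (n - d + 1) → Euc n,
    ContDiff ℝ (⊤ : ℕ∞) (fun p : ℝ × Euc (n - d + 1) => Γ p.1 p.2) ∧
    Set.EqOn (Γ 0) γ (sph (n - d)) ∧ Set.EqOn (Γ 1) γ' (sph (n - d)) ∧
    ∀ t ∈ Icc (0 : ℝ) 1, IsEmbeddedSphere n d H (Γ t)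

/-- `C` is a family of smooth embeddings of `S^{n-d}` into `ℝ^n ∖ H` closed by isotopy. -/
def ClosedByIsotopy (n d : ℕ) (H : Set (Euc n)) (C : Set (Euc (n - d + 1) → Euc n)) : Prop :=
  (∀ γ ∈ C, IsEmbeddedSphere n d H γ) ∧
  ∀ γ ∈ C, ∀ γ' : Euc (n - d + 1) → Euc n,
    IsEmbeddedSphere n d H γ' → SphereIsotopic n d H γ γ' → γ' ∈ C

/-- `K` is a `C`-spanning set of `H`. -/
def IsSpanning (n d : ℕ) (C : Set (Euc (n - d + 1) → Euc n)) (K : Set (Euc n)) : Prop :=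
  ∀ γ ∈ C, (K ∩ γ '' sph (n - d)).Nonempty

/-- `F(H,C)`: the countably `H^d`-rectifiable relatively closed `C`-spanning sets of `H`. -/
def spanningClass (n d : ℕ) (H : Set (Euc n)) (C : Set (Euc (n - d + 1) → Euc n)) :
    Set (Set (Euc n)) :=
  {K | RelClosedIn Hᶜ K ∧ CountablyRectifiable d K ∧ IsSpanning n d C K}

/-- `Σ(H)`: Lipschitz maps homotopic to the identity through maps preserving `H`. -/
def SlidingMaps {n : ℕ} (H : Set (Euc n)) : Set (Euc n → Euc n) :=
  {φ | (∃ C : ℝ≥0, LipschitzWith C φ) ∧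
    ∃ Φ : ℝ → Euc n → Euc n, Continuous (fun p : ℝ × Euc n => Φ p.1 p.2) ∧
      Φ 0 = id ∧ Φ 1 = φ ∧ ∀ t ∈ Icc (0 : ℝ) 1, Φ t '' H ⊆ H}

/-- `A(H,K₀) = {φ(K₀) : φ ∈ Σ(H)}`. -/
def slidingClass {n : ℕ} (H K0 : Set (Euc n)) : Set (Set (Euc n)) :=
  {K | ∃ φ ∈ SlidingMaps H, K = φ '' K0}

/-- The cone competitor for `K` in `B(x,r)`. -/
def coneCompetitor {n : ℕ} (x : Euc n) (r : ℝ) (K : Set (Euc n)) : Set (Euc n) :=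
  (K \ ball x r) ∪
    {w | ∃ z ∈ K ∩ sphere x r, ∃ lam ∈ Icc (0 : ℝ) 1, w = lam • x + (1 - lam) • z}

/-- Values of a function of `t - round t` do not depend on the choice of nearest integer, provided
the function agrees at the endpoints of the unit cell. -/
lemma periodic_eq_of_abs_sub_le {ω : ℝ → ℝ} (hω : ω (1 / 2) = ω (-(1 / 2))) {t : ℝ} {c : ℤ}
    (h : |t - c| ≤ 1 / 2) : ω (t - round t) = ω (t - c) := by
  rw [abs_le] at h
  rcases eq_or_lt_of_le h.2 with h1 | h1
  · have : round t = c + 1 := by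
      rw [round_eq, Int.floor_eq_iff]; push_cast; constructor <;> linarith
    rw [h1, hω, this]; congr 1; push_cast; linarith
  · have : round t = c := by
      rw [round_eq, Int.floor_eq_iff]; constructor <;> linarith
    rw [this]

lemma round_mem (t : ℝ) : (round t : ℝ) - 1 / 2 ≤ t ∧ t ≤ round t + 1 / 2 := by
  have := abs_le.1 (abs_sub_round t)
  constructor <;> linarith [this.1, this.2]

lemma round_mono' {s t : ℝ} (h : s ≤ t) : round s ≤ round t := by
  rw [round_eq, round_eq]; exact Int.floor_le_floor (by linarith)

/-- The periodic extension of a Lipschitz function vanishing at the ends of the unit cell. -/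
lemma periodic_lipschitz {ω : ℝ → ℝ} {L : ℝ}
    (hω : ∀ u v, |u| ≤ 1 / 2 → |v| ≤ 1 / 2 → |ω u - ω v| ≤ L * |u - v|)
    (h1 : ω (1 / 2) = 0) (h2 : ω (-(1 / 2)) = 0) (s t : ℝ) :
    |ω (s - round s) - ω (t - round t)| ≤ L * |s - t| := by
  wlog hst : s ≤ t generalizing s t
  · rw [abs_sub_comm, abs_sub_comm s t]; exact this t s (le_of_not_ge hst)
  rcases eq_or_lt_of_le (round_mono' hst) with h | h
  · have := hω _ _ (abs_sub_round s) (abs_sub_round t)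
    rw [h] at this ⊢
    simpa using this
  · have hs := hω _ (1 / 2) (abs_sub_round s) (by norm_num [abs_of_pos])
    have ht := hω _ (-(1 / 2)) (abs_sub_round t) (by norm_num [abs_of_pos])
    rw [h1, sub_zero] at hs
    rw [h2, sub_zero] at ht
    have hs' := (round_mem s).2
    have ht' := (round_mem t).1
    have h' : (round s : ℝ) + 1 ≤ round t := by exact_mod_cast h
    rw [abs_of_nonpos (a := s - round s - 1 / 2) (by linarith)] at hs
    rw [abs_of_nonneg (a := t - round t - -(1 / 2)) (by linarith)] at ht
    rw [abs_of_nonpos (a := s - t) (by linarith)]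
    have hL : 0 ≤ L := by
      have := (abs_nonneg _).trans (hω (1 / 2) (-(1 / 2)) (by norm_num [abs_of_pos])
        (by norm_num [abs_of_pos]))
      norm_num at this; exact this
    calc |ω (s - round s) - ω (t - round t)| ≤ |ω (s - round s)| + |ω (t - round t)| := abs_sub _ _
      _ ≤ _ := add_le_add hs ht
      _ = L * (t - s - (round t - round s - 1)) := by ring
      _ ≤ _ := by
        apply mul_le_mul_of_nonneg_left _ hL; linarith

/-- The map `t ↦ t + χ ω(t - round t)` is monotone when `u ↦ u + ω u` is, for `0 ≤ χ ≤ 1`. -/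
lemma periodic_monotone {ω : ℝ → ℝ}
    (hω : ∀ u v, |u| ≤ 1 / 2 → |v| ≤ 1 / 2 → u ≤ v → u + ω u ≤ v + ω v)
    (h1 : ω (1 / 2) = 0) (h2 : ω (-(1 / 2)) = 0) {s t : ℝ} (hst : s ≤ t) :
    s + ω (s - round s) ≤ t + ω (t - round t) := by
  rcases eq_or_lt_of_le (round_mono' hst) with h | h
  · have := hω _ _ (abs_sub_round s) (abs_sub_round t) (by rw [h]; linarith)
    rw [h] at this ⊢
    linarith
  · have hs := hω _ (1 / 2) (abs_sub_round s) (by norm_num [abs_of_pos])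
      (by linarith [(round_mem s).2])
    have ht := hω (-(1 / 2)) _ (by norm_num [abs_of_pos]) (abs_sub_round t)
      (by linarith [(round_mem t).1])
    have h' : (round s : ℝ) + 1 ≤ round t := by exact_mod_cast h
    rw [h1] at hs
    rw [h2] at ht
    linarith

/-- Distance to the nearest integer. -/
def cellDist (t : ℝ) : ℝ := |t - round t|

lemma cellDist_nonneg (t : ℝ) : 0 ≤ cellDist t := abs_nonneg _

lemma cellDist_le (t : ℝ) : cellDist t ≤ 1 / 2 := abs_sub_round t

lemma cellDist_eq {t : ℝ} {c : ℤ} (h : |t - c| ≤ 1 / 2) : cellDist t = |t - c| :=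
  periodic_eq_of_abs_sub_le (ω := fun u => |u|) (by norm_num) h

lemma cellDist_lipschitz (s t : ℝ) : |cellDist s - cellDist t| ≤ |s - t| := by
  have := periodic_lipschitz (ω := fun u => |u| - 1 / 2) (L := 1) (fun u v _ _ => by
    have := abs_abs_sub_abs_le_abs_sub u v
    rw [show |u| - 1 / 2 - (|v| - 1 / 2) = |u| - |v| by ring, one_mul]; exact this)
    (by norm_num [abs_of_pos]) (by norm_num [abs_of_pos]) s t
  rw [one_mul] at this
  rwa [show |s - round s| - 1 / 2 - (|t - round t| - 1 / 2) = cellDist s - cellDist t by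
    unfold cellDist; ring] at this

lemma cellDist_eq_zero_iff {t : ℝ} : cellDist t = 0 ↔ ∃ z : ℤ, t = z := by
  constructor
  · intro h
    exact ⟨round t, by rw [cellDist, abs_eq_zero] at h; linarith⟩
  · rintro ⟨z, rfl⟩
    simp [cellDist]

lemma continuous_cellDist : Continuous cellDist := by
  refine continuous_iff_continuousAt.2 fun t => ?_
  have : LipschitzWith 1 cellDist := LipschitzWith.of_dist_le_mul fun s t => by
    simpa [Real.dist_eq] using cellDist_lipschitz s t
  exact this.continuous.continuousAt

/-- The periodic logistic vector field. -/
def logField (t : ℝ) : ℝ := (t - round t) * (1 - 2 * |t - round t|)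

lemma logField_eq {t : ℝ} {c : ℤ} (h : |t - c| ≤ 1 / 2) :
    logField t = (t - c) * (1 - 2 * |t - c|) :=
  periodic_eq_of_abs_sub_le (ω := fun u => u * (1 - 2 * |u|)) (by norm_num [abs_of_pos]) h

lemma abs_logField_le (t : ℝ) : |logField t| ≤ cellDist t := by
  rw [logField, abs_mul, cellDist]
  have h := abs_sub_round t
  have h0 := abs_nonneg (t - round t)
  rw [abs_of_nonneg (a := 1 - 2 * _) (by linarith)]
  nlinarith

lemma logField_lipschitz (s t : ℝ) : |logField s - logField t| ≤ 3 * |s - t| := by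
  refine periodic_lipschitz (ω := fun u => u * (1 - 2 * |u|)) (L := 3) (fun u v hu hv => ?_)
    (by norm_num [abs_of_pos]) (by norm_num [abs_of_pos]) s t
  have h1 := abs_abs_sub_abs_le_abs_sub u v
  calc |u * (1 - 2 * |u|) - v * (1 - 2 * |v|)|
      = |(u - v) - 2 * u * (|u| - |v|) - 2 * |v| * (u - v)| := by congr 1; ring
    _ ≤ |u - v| + |2 * u * (|u| - |v|)| + |2 * |v| * (u - v)| :=
        (abs_sub _ _).trans (add_le_add_left (abs_sub _ _) _)
    _ = |u - v| + 2 * |u| * |(|u| - |v|)| + 2 * |v| * |u - v| := by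
        simp only [abs_mul, abs_abs, abs_two]
    _ ≤ |u - v| + 1 * |u - v| + 1 * |u - v| := by
        gcongr <;> linarith
    _ = _ := by ring

/-- The truncated logistic coordinate `min (2 a / (1 - 2 a)) 1`. -/
def logCoord (a : ℝ) : ℝ := 2 * a / max (2 * a) (1 - 2 * a)

lemma half_le_max (a : ℝ) : 1 / 2 ≤ max (2 * a) (1 - 2 * a) := by
  rcases le_total (2 * a) (1 / 2) with h | h
  · exact le_max_of_le_right (by linarith)
  · exact le_max_of_le_left h

lemma logCoord_nonneg {a : ℝ} (h : 0 ≤ a) : 0 ≤ logCoord a :=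
  div_nonneg (by linarith) (by linarith [half_le_max a])

lemma logCoord_le_one (a : ℝ) : logCoord a ≤ 1 := by
  have := half_le_max a
  rw [logCoord, div_le_one (by linarith)]; exact le_max_left _ _

lemma logCoord_of_le {a : ℝ} (h : a ≤ 1 / 4) : logCoord a = 2 * a / (1 - 2 * a) := by
  rw [logCoord, max_eq_right (by linarith)]

lemma logCoord_of_ge {a : ℝ} (h : 1 / 4 ≤ a) : logCoord a = 1 := by
  rw [logCoord, max_eq_left (by linarith), div_self (by linarith)]

lemma logCoord_mono {a b : ℝ} (h : a ≤ b) : logCoord a ≤ logCoord b := by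
  rcases le_total (1 / 4) b with hb | hb
  · rw [logCoord_of_ge hb]; exact logCoord_le_one a
  · rw [logCoord_of_le hb, logCoord_of_le (h.trans hb),
      div_le_div_iff₀ (by linarith) (by linarith)]
    nlinarith

lemma le_logCoord {a : ℝ} (h0 : 0 ≤ a) (h : logCoord a < 1) : 2 * a ≤ logCoord a := by
  have h4 : a < 1 / 4 := by
    by_contra h4; rw [logCoord_of_ge (not_lt.1 h4)] at h; exact lt_irrefl _ h
  rw [logCoord_of_le h4.le, le_div_iff₀ (by linarith)]
  nlinarith

lemma logCoord_le {a : ℝ} (h0 : 0 ≤ a) : logCoord a ≤ 4 * a := by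
  have := half_le_max a
  rw [logCoord, div_le_iff₀ (by linarith)]
  nlinarith

lemma abs_div_sub_div_le {a₁ a₂ b₁ b₂ ρ : ℝ} (h₁ : 0 < b₁) (h₂ : 0 < b₂) (hρ : |a₂ / b₂| ≤ ρ) :
    |a₁ / b₁ - a₂ / b₂| ≤ (|a₁ - a₂| + ρ * |b₁ - b₂|) / b₁ := by
  have : a₁ / b₁ - a₂ / b₂ = ((a₁ - a₂) - a₂ / b₂ * (b₁ - b₂)) / b₁ := by
    field_simp; ring
  rw [this, abs_div, abs_of_pos h₁]
  gcongr
  refine (abs_sub _ _).trans ?_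
  rw [abs_mul]
  gcongr

lemma logCoord_lipschitz {a b : ℝ} (hb : 0 ≤ b) :
    |logCoord a - logCoord b| ≤ 8 * |a - b| := by
  have h1 := half_le_max a
  have h2 := half_le_max b
  have h3 : |logCoord b| ≤ 1 := by
    rw [abs_of_nonneg (logCoord_nonneg hb)]; exact logCoord_le_one b
  refine (abs_div_sub_div_le (by linarith) (by linarith) h3).trans ?_
  have h4 : |max (2 * a) (1 - 2 * a) - max (2 * b) (1 - 2 * b)| ≤ 2 * |a - b| := by
    refine (abs_max_sub_max_le_max _ _ _ _).trans (max_le ?_ ?_)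
    · rw [← mul_sub, abs_mul, abs_two]
    · rw [show 1 - 2 * a - (1 - 2 * b) = -(2 * (a - b)) by ring, abs_neg, abs_mul, abs_two]
  have h5 : |2 * a - 2 * b| = 2 * |a - b| := by rw [← mul_sub, abs_mul, abs_two]
  rw [div_le_iff₀ (by linarith), h5, one_mul]
  nlinarith [abs_nonneg (a - b)]

/-- The displacement of the logistic flow at scale `σ`. -/
def logDisp (σ t : ℝ) : ℝ := (1 - σ) * logField t / (σ + 2 * (1 - σ) * cellDist t)

lemma logDisp_denom_pos {σ : ℝ} (h0 : 0 < σ) (h1 : σ ≤ 1) (t : ℝ) :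
    0 < σ + 2 * (1 - σ) * cellDist t := by
  have := cellDist_nonneg t
  have : 0 ≤ 2 * (1 - σ) * cellDist t := mul_nonneg (by linarith) this
  linarith

/-- The logistic flow in a unit cell. -/
lemma add_logDisp {σ t : ℝ} (h0 : 0 < σ) (h1 : σ ≤ 1) {c : ℤ} (h : |t - c| ≤ 1 / 2) :
    t + logDisp σ t = c + (t - c) / (σ + 2 * (1 - σ) * |t - c|) := by
  have hp := logDisp_denom_pos h0 h1 t
  rw [logDisp, logField_eq h, cellDist_eq h]
  rw [cellDist_eq h] at hp
  rw [← sub_eq_iff_eq_add', add_sub_right_comm, ← eq_sub_iff_add_eq', ← sub_eq_zero,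
    sub_sub_eq_add_sub, div_add' _ _ _ hp.ne', ← sub_div, div_eq_zero_iff]
  left
  ring

lemma abs_add_logDisp_sub {σ t : ℝ} (h0 : 0 < σ) (h1 : σ ≤ 1) {c : ℤ} (h : |t - c| ≤ 1 / 2) :
    |t + logDisp σ t - c| = |t - c| / (σ + 2 * (1 - σ) * |t - c|) := by
  have hp := logDisp_denom_pos h0 h1 t
  rw [cellDist_eq h] at hp
  rw [add_logDisp h0 h1 h, add_sub_cancel_left, abs_div, abs_of_pos hp]

lemma abs_add_logDisp_sub_le {σ t : ℝ} (h0 : 0 < σ) (h1 : σ ≤ 1) {c : ℤ} (h : |t - c| ≤ 1 / 2) :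
    |t + logDisp σ t - c| ≤ 1 / 2 := by
  have hp := logDisp_denom_pos h0 h1 t
  rw [cellDist_eq h] at hp
  rw [abs_add_logDisp_sub h0 h1 h, div_le_iff₀ hp]
  nlinarith

lemma logDisp_comp {σ τ t : ℝ} (h0 : 0 < σ) (h1 : σ ≤ 1) (k0 : 0 < τ) (k1 : τ ≤ 1) :
    t + logDisp σ t + logDisp τ (t + logDisp σ t) = t + logDisp (σ * τ) t := by
  have h := abs_sub_round t
  have hp := logDisp_denom_pos h0 h1 t
  have hq := logDisp_denom_pos (mul_pos h0 k0) (by nlinarith) t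
  rw [add_logDisp k0 k1 (abs_add_logDisp_sub_le h0 h1 h), add_logDisp (mul_pos h0 k0)
    (by nlinarith) h, abs_add_logDisp_sub h0 h1 h, add_logDisp h0 h1 h, add_sub_cancel_left]
  rw [cellDist_eq h] at hp hq
  set a := |t - round t| with ha
  have hh : τ + 2 * (1 - τ) * (a / (σ + 2 * (1 - σ) * a)) =
      (σ * τ + 2 * (1 - σ * τ) * a) / (σ + 2 * (1 - σ) * a) := by
    rw [eq_div_iff hp.ne', add_mul, mul_assoc _ (a / _), div_mul_cancel₀ _ hp.ne']; ring
  rw [hh, div_div_div_cancel_right₀ hp.ne']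

lemma cellDist_add_logDisp {σ t : ℝ} (h0 : 0 < σ) (h1 : σ ≤ 1) :
    cellDist (t + logDisp σ t) = cellDist t / (σ + 2 * (1 - σ) * cellDist t) := by
  have h := abs_sub_round t
  rw [cellDist_eq (abs_add_logDisp_sub_le h0 h1 h), abs_add_logDisp_sub h0 h1 h]; rfl

lemma logCoord_scale {σ a : ℝ} (h0 : 0 < σ) (h1 : σ ≤ 1) (ha : 0 ≤ a) :
    logCoord (a / (σ + 2 * (1 - σ) * a)) = min 1 (logCoord a / σ) := by
  have hp : 0 < σ + 2 * (1 - σ) * a := by nlinarith [mul_nonneg (sub_nonneg.2 h1) ha]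
  rcases le_total (a / (σ + 2 * (1 - σ) * a)) (1 / 4) with h | h
  · have h' := h
    rw [div_le_iff₀ hp] at h
    have hle : a ≤ 1 / 4 := by nlinarith [mul_nonneg (sub_nonneg.2 h1) ha]
    have h3 : 2 * a / (1 - 2 * a) / σ ≤ 1 := by
      rw [div_div, div_le_one (by nlinarith)]; nlinarith
    rw [logCoord_of_le h', logCoord_of_le hle, min_eq_right h3]
    have h2 : 1 - 2 * (a / (σ + 2 * (1 - σ) * a)) =
      σ * (1 - 2 * a) / (σ + 2 * (1 - σ) * a) := by
      rw [eq_div_iff hp.ne', sub_mul, mul_assoc 2 (a / _), div_mul_cancel₀ _ hp.ne']; ring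
    rw [h2, ← mul_div_assoc, div_div_div_cancel_right₀ hp.ne', div_div, mul_comm σ]
  · rw [logCoord_of_ge h]
    symm
    apply min_eq_left
    rw [le_div_iff₀ h0, one_mul]
    rcases le_total a (1 / 4) with hle | hle
    · rw [le_div_iff₀ hp] at h
      rw [logCoord_of_le hle, le_div_iff₀ (by linarith)]
      nlinarith
    · rw [logCoord_of_ge hle]; exact h1

lemma logCoord_cellDist_add_logDisp {σ t : ℝ} (h0 : 0 < σ) (h1 : σ ≤ 1) :
    logCoord (cellDist (t + logDisp σ t)) = min 1 (logCoord (cellDist t) / σ) := by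
  rw [cellDist_add_logDisp h0 h1, logCoord_scale h0 h1 (cellDist_nonneg t)]

/-- The wall coordinate: it vanishes for `|t| ≤ N` and equals `1` for `|t| ≥ N + 1/4`. -/
def wallCoord (N : ℕ) (t : ℝ) : ℝ := logCoord (max (|t| - N) 0)

lemma wallCoord_nonneg (N : ℕ) (t : ℝ) : 0 ≤ wallCoord N t := logCoord_nonneg (le_max_right _ _)

lemma wallCoord_le_one (N : ℕ) (t : ℝ) : wallCoord N t ≤ 1 := logCoord_le_one _

lemma wallCoord_lipschitz (N : ℕ) (s t : ℝ) : |wallCoord N s - wallCoord N t| ≤ 8 * |s - t| := by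
  refine (logCoord_lipschitz (le_max_right _ _)).trans ?_
  refine mul_le_mul_of_nonneg_left ?_ (by norm_num)
  refine (abs_max_sub_max_le_max (|s| - N) 0 (|t| - N) 0).trans (max_le ?_ ?_)
  swap
  · rw [sub_self, abs_zero]; exact abs_nonneg (s - t)
  rw [sub_sub_sub_cancel_right]
  exact abs_abs_sub_abs_le_abs_sub s t

lemma wallCoord_of_le {N : ℕ} {t : ℝ} (h : |t| ≤ N) : wallCoord N t = 0 := by
  rw [wallCoord, max_eq_right (by linarith)]; simp [logCoord]

lemma wallCoord_of_ge {N : ℕ} {t : ℝ} (h : (N : ℝ) + 1 / 4 ≤ |t|) : wallCoord N t = 1 := by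
  rw [wallCoord, logCoord_of_ge (le_max_of_le_left (by linarith))]

lemma wallCoord_eq {N : ℕ} {t : ℝ} (h : (N : ℝ) < |t|) (h' : |t| ≤ N + 1 / 2) :
    wallCoord N t = logCoord (cellDist t) ∧ cellDist t = |t| - N := by
  have : cellDist t = |t| - N := by
    rcases le_total 0 t with h0 | h0
    · rw [abs_of_nonneg h0] at *
      rw [cellDist_eq (c := N) (by rw [abs_le]; push_cast; constructor <;> linarith)]
      push_cast
      exact abs_of_pos (by linarith)
    · rw [abs_of_nonpos h0] at *
      rw [cellDist_eq (c := -N) (by rw [abs_le]; push_cast; constructor <;> linarith)]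
      push_cast
      rw [abs_of_neg (by linarith)]; ring
  rw [wallCoord, this, max_eq_left (by linarith)]
  exact ⟨rfl, rfl⟩

lemma add_logDisp_le {σ t : ℝ} (h0 : 0 < σ) (h1 : σ ≤ 1) {m : ℤ} (h : t ≤ m) :
    t + logDisp σ t ≤ m := by
  have hc := abs_sub_round t
  have hp := logDisp_denom_pos h0 h1 t
  rcases le_or_gt (round t + 1) m with hm | hm
  · have h2 := abs_le.1 (abs_add_logDisp_sub_le h0 h1 hc)
    have : (round t : ℝ) + 1 ≤ m := by exact_mod_cast hm
    linarith [h2.2]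
  · have hmc : (m : ℝ) ≤ round t := by exact_mod_cast Int.lt_add_one_iff.1 hm
    have : round t ≤ m := by
      have : (round t : ℝ) < m + 1 := by linarith [(abs_le.1 hc).1]
      exact Int.lt_add_one_iff.1 (by exact_mod_cast this)
    have hcm : (round t : ℝ) ≤ m := by exact_mod_cast this
    rw [add_logDisp h0 h1 hc]
    have : (t - round t) / (σ + 2 * (1 - σ) * |t - round t|) ≤ 0 :=
      div_nonpos_of_nonpos_of_nonneg (by linarith) hp.le
    linarith

lemma le_add_logDisp {σ t : ℝ} (h0 : 0 < σ) (h1 : σ ≤ 1) {m : ℤ} (h : (m : ℝ) ≤ t) :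
    m ≤ t + logDisp σ t := by
  have hc := abs_sub_round t
  have hp := logDisp_denom_pos h0 h1 t
  rcases le_or_gt (m + 1) (round t) with hm | hm
  · have h2 := abs_le.1 (abs_add_logDisp_sub_le h0 h1 hc)
    have : (m : ℝ) + 1 ≤ round t := by exact_mod_cast hm
    linarith [h2.1]
  · have hmc : (round t : ℝ) ≤ m := by exact_mod_cast Int.lt_add_one_iff.1 hm
    have : m ≤ round t := by
      have : (m : ℝ) < round t + 1 := by linarith [(abs_le.1 hc).2]
      exact Int.lt_add_one_iff.1 (by exact_mod_cast this)
    have hcm : (m : ℝ) ≤ round t := by exact_mod_cast this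
    rw [add_logDisp h0 h1 hc]
    have : 0 ≤ (t - round t) / (σ + 2 * (1 - σ) * |t - round t|) :=
      div_nonneg (by linarith) hp.le
    linarith

lemma wallCoord_add_logDisp {N : ℕ} {σ t : ℝ} (h0 : 0 < σ) (h1 : σ ≤ 1) (h : wallCoord N t < 1) :
    wallCoord N (t + logDisp σ t) = min 1 (wallCoord N t / σ) := by
  have ht : |t| < N + 1 / 4 := by
    by_contra hc
    rw [wallCoord_of_ge (not_lt.1 hc)] at h; exact lt_irrefl _ h
  rcases le_or_gt |t| N with hN | hN
  · have : |t + logDisp σ t| ≤ N := by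
      rw [abs_le] at hN ⊢
      have e1 := le_add_logDisp h0 h1 (m := -N) (t := t) (by push_cast; exact hN.1)
      have e2 := add_logDisp_le h0 h1 (m := N) (t := t) (by push_cast; exact hN.2)
      push_cast at e1 e2
      exact ⟨e1, e2⟩
    rw [wallCoord_of_le this, wallCoord_of_le hN, zero_div, min_eq_right zero_le_one]
  · obtain ⟨e1, -⟩ := wallCoord_eq hN (by linarith)
    have hN' : (N : ℝ) < |t + logDisp σ t| ∧ |t + logDisp σ t| ≤ N + 1 / 2 := by
      rcases le_total 0 t with h0' | h0'
      · rw [abs_of_nonneg h0'] at *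
        have hc : |t - (N : ℤ)| ≤ 1 / 2 := by
          rw [abs_le]; push_cast; constructor <;> linarith
        have e := abs_add_logDisp_sub_le h0 h1 hc
        have hp := logDisp_denom_pos h0 h1 t
        rw [cellDist_eq hc] at hp
        have hlt : (N : ℝ) < t + logDisp σ t := by
          rw [add_logDisp h0 h1 hc]
          have := div_pos (a := t - (N : ℤ)) (by push_cast; linarith) hp
          push_cast at this ⊢
          linarith
        have hN0 : (0 : ℝ) ≤ N := Nat.cast_nonneg N
        rw [abs_of_nonneg (by linarith)]
        refine ⟨hlt, ?_⟩
        have := (abs_le.1 e).2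
        push_cast at this
        linarith
      · rw [abs_of_nonpos h0'] at *
        have hc : |t - (-N : ℤ)| ≤ 1 / 2 := by
          rw [abs_le]; push_cast; constructor <;> linarith
        have e := abs_add_logDisp_sub_le h0 h1 hc
        have hp := logDisp_denom_pos h0 h1 t
        rw [cellDist_eq hc] at hp
        have hlt : t + logDisp σ t < -N := by
          rw [add_logDisp h0 h1 hc]
          have := div_neg_of_neg_of_pos (a := t - (-N : ℤ)) (by push_cast; linarith) hp
          push_cast at this ⊢
          linarith
        have hN0 : (0 : ℝ) ≤ N := Nat.cast_nonneg N
        rw [abs_of_nonpos (by linarith)]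
        refine ⟨by linarith, ?_⟩
        have := (abs_le.1 e).1
        push_cast at this
        linarith
    rw [(wallCoord_eq hN'.1 hN'.2).1, e1, logCoord_cellDist_add_logDisp h0 h1]

lemma min_one_add_le {a b : ℝ} (ha : 0 ≤ a) (hb : 0 ≤ b) :
    min 1 (a + b) ≤ min 1 a + min 1 b := by
  rcases le_total 1 a with h | h
  · rw [min_eq_left h]
    exact (min_le_left _ _).trans (le_add_of_nonneg_right (le_min zero_le_one hb))
  · rcases le_total 1 b with h' | h'
    · rw [min_eq_left h']
      exact (min_le_left _ _).trans (le_add_of_nonneg_left (le_min zero_le_one ha))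
    · rw [min_eq_right h, min_eq_right h']; exact min_le_right _ _

lemma min_one_sum_le {ι : Type*} (s : Finset ι) {a : ι → ℝ} (ha : ∀ i, 0 ≤ a i) :
    min 1 (∑ i ∈ s, a i) ≤ ∑ i ∈ s, min 1 (a i) := by
  classical
  induction s using Finset.induction_on with
  | empty => simp
  | insert i s hi ih =>
    rw [Finset.sum_insert hi, Finset.sum_insert hi]
    exact (min_one_add_le (ha i) (Finset.sum_nonneg fun j _ => ha j)).trans (by gcongr)

/-- The sum of the logistic coordinates with index in `I`. -/
def cellSum {n : ℕ} (I : Finset (Fin n)) (x : Euc n) : ℝ := ∑ i ∈ I, logCoord (cellDist (x i))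

/-- The sum of the wall coordinates. -/
def wallSum {n : ℕ} (N : ℕ) (x : Euc n) : ℝ := ∑ j, wallCoord N (x j)

/-- The minimum of the functions `cellSum I + wallSum N` over `I` of cardinality `d`, and `1`. -/
def latMin {n : ℕ} (d N : ℕ) (x : Euc n) : ℝ :=
  (Finset.powersetCard d Finset.univ).fold min 1 fun I => cellSum I x + wallSum N x

section latMin

variable {n d N : ℕ} {x y : Euc n} {I : Finset (Fin n)}

lemma cellSum_nonneg : 0 ≤ cellSum I x :=
  Finset.sum_nonneg fun _ _ => logCoord_nonneg (cellDist_nonneg _)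

lemma wallSum_nonneg : 0 ≤ wallSum N x := Finset.sum_nonneg fun _ _ => wallCoord_nonneg _ _

lemma wallCoord_le_wallSum (j : Fin n) : wallCoord N (x j) ≤ wallSum N x :=
  Finset.single_le_sum (f := fun j => wallCoord N (x j)) (fun _ _ => wallCoord_nonneg _ _)
    (Finset.mem_univ j)

lemma abs_sub_apply_le (x y : Euc n) (i : Fin n) : |x i - y i| ≤ ‖x - y‖ := by
  simpa using PiLp.norm_apply_le (x - y) i

lemma norm_le_card_mul {B : ℝ} (h : ∀ i, |x i| ≤ B) : ‖x‖ ≤ n * B := by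
  have hx : x = ∑ i, x i • EuclideanSpace.basisFun (Fin n) ℝ i :=
    ((EuclideanSpace.basisFun (Fin n) ℝ).sum_repr x).symm
  calc ‖x‖ = ‖∑ i, x i • EuclideanSpace.basisFun (Fin n) ℝ i‖ := by rw [← hx]
    _ ≤ ∑ i, ‖x i • EuclideanSpace.basisFun (Fin n) ℝ i‖ := norm_sum_le _ _
    _ ≤ ∑ _i : Fin n, B := Finset.sum_le_sum fun i _ => by simpa [norm_smul] using h i
    _ = n * B := by simp

lemma abs_cellSum_sub_le : |cellSum I x - cellSum I y| ≤ 8 * n * ‖x - y‖ := by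
  rw [cellSum, cellSum, ← Finset.sum_sub_distrib]
  calc _ ≤ ∑ i ∈ I, |logCoord (cellDist (x i)) - logCoord (cellDist (y i))| :=
        Finset.abs_sum_le_sum_abs _ _
    _ ≤ ∑ _i ∈ I, 8 * ‖x - y‖ := Finset.sum_le_sum fun i _ =>
        (logCoord_lipschitz (cellDist_nonneg _)).trans (mul_le_mul_of_nonneg_left
          ((cellDist_lipschitz _ _).trans (abs_sub_apply_le x y i)) (by norm_num))
    _ = I.card * (8 * ‖x - y‖) := by simp
    _ ≤ n * (8 * ‖x - y‖) := by
        gcongr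
        exact_mod_cast (Finset.card_le_univ I).trans_eq (Fintype.card_fin n)
    _ = _ := by ring

lemma abs_wallSum_sub_le : |wallSum N x - wallSum N y| ≤ 8 * n * ‖x - y‖ := by
  rw [wallSum, wallSum, ← Finset.sum_sub_distrib]
  calc _ ≤ ∑ i, |wallCoord N (x i) - wallCoord N (y i)| := Finset.abs_sum_le_sum_abs _ _
    _ ≤ ∑ _i : Fin n, 8 * ‖x - y‖ := Finset.sum_le_sum fun i _ =>
        (wallCoord_lipschitz N _ _).trans (mul_le_mul_of_nonneg_left
          (abs_sub_apply_le x y i) (by norm_num))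
    _ = _ := by simp; ring

lemma le_latMin_iff {c : ℝ} : c ≤ latMin d N x ↔
    c ≤ 1 ∧ ∀ I : Finset (Fin n), I.card = d → c ≤ cellSum I x + wallSum N x := by
  rw [latMin, Finset.le_fold_min]
  simp [Finset.mem_powersetCard]

lemma latMin_le_one : latMin d N x ≤ 1 := (le_latMin_iff.1 le_rfl).1

lemma latMin_le (hI : I.card = d) : latMin d N x ≤ cellSum I x + wallSum N x :=
  (le_latMin_iff.1 le_rfl).2 I hI

lemma latMin_nonneg : 0 ≤ latMin d N x :=
  le_latMin_iff.2 ⟨zero_le_one, fun _ _ => add_nonneg cellSum_nonneg wallSum_nonneg⟩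

lemma exists_latMin_eq (h : latMin d N x < 1) :
    ∃ I : Finset (Fin n), I.card = d ∧ latMin d N x = cellSum I x + wallSum N x := by
  have h1 : latMin d N x ≤ latMin d N x := le_rfl
  nth_rw 1 [latMin] at h1
  rw [Finset.fold_min_le] at h1
  rcases h1 with h1 | ⟨I, hI, h1⟩
  · exact absurd h1 (not_le.2 h)
  · have hc := (Finset.mem_powersetCard.1 hI).2
    exact ⟨I, hc, le_antisymm (latMin_le hc) h1⟩

lemma min_one_wallSum_le_latMin : min 1 (wallSum N x) ≤ latMin d N x :=
  le_latMin_iff.2 ⟨min_le_left _ _, fun _ _ =>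
    (min_le_right _ _).trans (le_add_of_nonneg_left cellSum_nonneg)⟩

lemma wallCoord_le_latMin (j : Fin n) : wallCoord N (x j) ≤ latMin d N x :=
  (le_min (wallCoord_le_one _ _) (wallCoord_le_wallSum j)).trans min_one_wallSum_le_latMin

lemma abs_latMin_sub_le : |latMin d N x - latMin d N y| ≤ 16 * n * ‖x - y‖ := by
  have key : ∀ x y : Euc n, latMin d N x - latMin d N y ≤ 16 * n * ‖x - y‖ := by
    intro x y
    rw [sub_le_comm, le_latMin_iff]
    have h0 : 0 ≤ 16 * n * ‖x - y‖ := by positivity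
    refine ⟨by linarith [latMin_le_one (d := d) (N := N) (x := x)], fun I hI => ?_⟩
    have h1 := (abs_le.1 (abs_cellSum_sub_le (I := I) (x := x) (y := y))).2
    have h2 := (abs_le.1 (abs_wallSum_sub_le (N := N) (x := x) (y := y))).2
    have h3 := latMin_le (N := N) (x := x) hI
    linarith
  rw [abs_le]
  refine ⟨?_, key x y⟩
  have := key y x
  rw [norm_sub_rev] at this
  linarith

/-- The scale `M + (1 - M) θ`, where `M = latMin d N`. -/
def latScale {n : ℕ} (d N : ℕ) (θ : ℝ) (x : Euc n) : ℝ :=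
  latMin d N x + (1 - latMin d N x) * θ

/-- The logistic flow in all coordinates, slowed down near the dual skeleton of dimension `n - d`
and stopped at the walls. -/
def latFlow {n : ℕ} (d N : ℕ) (θ : ℝ) (x : Euc n) : Euc n :=
  WithLp.toLp 2 fun i => x i + logDisp (latScale d N θ x) (x i)

variable {θ τ : ℝ}

@[simp] lemma latFlow_apply (i : Fin n) :
    latFlow d N θ x i = x i + logDisp (latScale d N θ x) (x i) := rfl

lemma latScale_le_one (h1 : θ ≤ 1) : latScale d N θ x ≤ 1 := by
  have h := latMin_le_one (d := d) (N := N) (x := x)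
  unfold latScale
  nlinarith [mul_nonneg (sub_nonneg.2 h) (sub_nonneg.2 h1)]

lemma latMin_le_latScale (h0 : 0 ≤ θ) : latMin d N x ≤ latScale d N θ x :=
  le_add_of_nonneg_right (mul_nonneg (sub_nonneg.2 latMin_le_one) h0)

lemma le_latScale (h1 : θ ≤ 1) : θ ≤ latScale d N θ x := by
  have h := latMin_nonneg (d := d) (N := N) (x := x)
  unfold latScale
  nlinarith

lemma latScale_pos (h0 : 0 < θ) (h1 : θ ≤ 1) : 0 < latScale d N θ x :=
  h0.trans_le (le_latScale h1)

lemma latFlow_eq_self (h : latMin d N x = 1) : latFlow d N θ x = x := by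
  ext i
  simp [latScale, h, logDisp]

lemma latFlow_eq_self_of_le {j : Fin n} (h : N + 1 / 4 ≤ |x j|) : latFlow d N θ x = x :=
  latFlow_eq_self (le_antisymm latMin_le_one ((wallCoord_of_ge h).symm.le.trans
    (wallCoord_le_latMin j)))

lemma latMin_latFlow (h0 : 0 < θ) (h1 : θ ≤ 1) :
    latMin d N (latFlow d N θ x) = latMin d N x / latScale d N θ x := by
  have hs0 := latScale_pos (d := d) (N := N) (x := x) h0 h1
  have hs1 := latScale_le_one (d := d) (N := N) (x := x) h1
  rcases eq_or_lt_of_le (latMin_le_one (d := d) (N := N) (x := x)) with h | h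
  · rw [latFlow_eq_self h, latScale, h]; simp
  have hV : ∀ I, cellSum I (latFlow d N θ x) =
      ∑ i ∈ I, min 1 (logCoord (cellDist (x i)) / latScale d N θ x) := fun I =>
    Finset.sum_congr rfl fun i _ => by rw [latFlow_apply, logCoord_cellDist_add_logDisp hs0 hs1]
  have hB : wallSum N (latFlow d N θ x) =
      ∑ i, min 1 (wallCoord N (x i) / latScale d N θ x) :=
    Finset.sum_congr rfl fun i _ => by
      rw [latFlow_apply, wallCoord_add_logDisp hs0 hs1 ((wallCoord_le_latMin i).trans_lt h)]
  apply le_antisymm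
  · obtain ⟨I, hI, hM⟩ := exists_latMin_eq h
    refine (latMin_le hI).trans ?_
    rw [hM, add_div, hV, hB, cellSum, wallSum, Finset.sum_div, Finset.sum_div]
    gcongr <;> exact min_le_right _ _
  · rw [le_latMin_iff]
    refine ⟨(div_le_one hs0).2 (latMin_le_latScale h0.le), fun I hI => ?_⟩
    have e1 := min_one_sum_le I (a := fun i => logCoord (cellDist (x i)) / latScale d N θ x)
      fun i => div_nonneg (logCoord_nonneg (cellDist_nonneg _)) hs0.le
    have e2 := min_one_sum_le Finset.univ (a := fun i => wallCoord N (x i) / latScale d N θ x)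
      fun i => div_nonneg (wallCoord_nonneg _ _) hs0.le
    rw [← Finset.sum_div] at e1 e2
    rw [hV, hB]
    refine le_trans ?_ (add_le_add e1 e2)
    refine le_trans (le_min ?_ ?_) (min_one_add_le (div_nonneg cellSum_nonneg hs0.le)
      (div_nonneg wallSum_nonneg hs0.le))
    · exact (div_le_one hs0).2 (latMin_le_latScale h0.le)
    · rw [← add_div]
      exact div_le_div_of_nonneg_right (latMin_le hI) hs0.le

lemma latFlow_comp (h0 : 0 < θ) (h1 : θ ≤ 1) (k0 : 0 < τ) (k1 : τ ≤ 1) (x : Euc n) :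
    latFlow d N τ (latFlow d N θ x) = latFlow d N (θ * τ) x := by
  have hs0 := latScale_pos (d := d) (N := N) (x := x) h0 h1
  have hs1 := latScale_le_one (d := d) (N := N) (x := x) h1
  ext i
  rw [latFlow_apply, latFlow_apply, logDisp_comp hs0 hs1 (latScale_pos k0 k1) (latScale_le_one k1),
    latFlow_apply]
  congr 2
  have e : latScale d N τ (latFlow d N θ x) = latMin d N x / latScale d N θ x +
      (1 - latMin d N x / latScale d N θ x) * τ := by rw [latScale, latMin_latFlow h0 h1]
  rw [e, mul_add, ← mul_assoc, mul_sub, mul_div_cancel₀ _ hs0.ne', mul_one]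
  unfold latScale; ring

lemma abs_logDisp_le {σ t : ℝ} (h0 : 0 < σ) (h1 : σ ≤ 1) : |logDisp σ t| ≤ 1 / 2 := by
  have hp := logDisp_denom_pos h0 h1 t
  rw [logDisp, abs_div, abs_mul, abs_of_pos hp, abs_of_nonneg (sub_nonneg.2 h1), div_le_iff₀ hp]
  have := mul_le_mul_of_nonneg_left (abs_logField_le t) (sub_nonneg.2 h1)
  nlinarith

lemma norm_latFlow_sub_sub_le (h0 : 0 < θ) (h1 : θ ≤ 1) :
    ‖(latFlow d N θ x - x) - (latFlow d N θ y - y)‖ ≤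
      (1 - θ) * (n * (16 * n + 4)) / latScale d N θ x * ‖x - y‖ := by
  have hs0 := latScale_pos (d := d) (N := N) (x := x) h0 h1
  have hs1 := latScale_le_one (d := d) (N := N) (x := x) h1
  have ht0 := latScale_pos (d := d) (N := N) (x := y) h0 h1
  have ht1 := latScale_le_one (d := d) (N := N) (x := y) h1
  have hd : |latScale d N θ x - latScale d N θ y| ≤ (1 - θ) * (16 * n * ‖x - y‖) := by
    rw [show latScale d N θ x - latScale d N θ y = (1 - θ) * (latMin d N x - latMin d N y) by
      unfold latScale; ring, abs_mul, abs_of_nonneg (sub_nonneg.2 h1)]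
    exact mul_le_mul_of_nonneg_left abs_latMin_sub_le (sub_nonneg.2 h1)
  have hσ : 1 - latScale d N θ x ≤ 1 - θ := by linarith [le_latScale (d := d) (N := N) (x := x) h1]
  refine (norm_le_card_mul (B := (1 - θ) * (16 * n + 4) / latScale d N θ x * ‖x - y‖)
    fun i => ?_).trans_eq (by ring)
  have hi := abs_sub_apply_le x y i
  set s := latScale d N θ x
  set t := latScale d N θ y
  have e : (latFlow d N θ x - x - (latFlow d N θ y - y)) i = logDisp s (x i) - logDisp t (y i) := by
    simp [s, t]
  have hp := logDisp_denom_pos hs0 hs1 (x i)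
  rw [e]
  refine (abs_div_sub_div_le hp (logDisp_denom_pos ht0 ht1 (y i))
    (abs_logDisp_le ht0 ht1)).trans ?_
  have a1 : |(1 - s) * logField (x i) - (1 - t) * logField (y i)| ≤
      (1 - θ) * ((3 + 8 * n) * ‖x - y‖) := by
    rw [show (1 - s) * logField (x i) - (1 - t) * logField (y i) =
      (1 - s) * (logField (x i) - logField (y i)) - (s - t) * logField (y i) by ring]
    refine (abs_sub _ _).trans ?_
    rw [abs_mul, abs_mul, abs_of_nonneg (sub_nonneg.2 hs1)]
    have b1 : (1 - s) * |logField (x i) - logField (y i)| ≤ (1 - θ) * (3 * ‖x - y‖) :=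
      mul_le_mul hσ ((logField_lipschitz _ _).trans (by linarith)) (abs_nonneg _) (by linarith)
    have b2 : |s - t| * |logField (y i)| ≤ (1 - θ) * (16 * n * ‖x - y‖) * (1 / 2) :=
      mul_le_mul hd ((abs_logField_le _).trans (cellDist_le _)) (abs_nonneg _)
        ((abs_nonneg _).trans hd)
    linarith
  have a2 : |s + 2 * (1 - s) * cellDist (x i) - (t + 2 * (1 - t) * cellDist (y i))| ≤
      (1 - θ) * ((2 + 16 * n) * ‖x - y‖) := by
    rw [show s + 2 * (1 - s) * cellDist (x i) - (t + 2 * (1 - t) * cellDist (y i)) =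
      (s - t) * (1 - 2 * cellDist (y i)) + 2 * ((1 - s) * (cellDist (x i) - cellDist (y i))) by
        ring]
    refine (abs_add_le _ _).trans ?_
    have c0 := cellDist_nonneg (y i)
    have c1 := cellDist_le (y i)
    rw [abs_mul, abs_mul, abs_mul, abs_two, abs_of_nonneg (sub_nonneg.2 hs1),
      abs_of_nonneg (a := 1 - 2 * cellDist (y i)) (by linarith)]
    have b1 : (1 - s) * |cellDist (x i) - cellDist (y i)| ≤ (1 - θ) * ‖x - y‖ :=
      mul_le_mul hσ ((cellDist_lipschitz _ _).trans hi) (abs_nonneg _) (by linarith)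
    have b2 : |s - t| * (1 - 2 * cellDist (y i)) ≤ (1 - θ) * (16 * n * ‖x - y‖) * 1 :=
      mul_le_mul hd (by linarith) (by linarith) ((abs_nonneg _).trans hd)
    linarith
  rw [div_mul_eq_mul_div _ s ‖x - y‖]
  have a3 : s ≤ s + 2 * (1 - s) * cellDist (x i) :=
    le_add_of_nonneg_right (mul_nonneg (by linarith) (cellDist_nonneg _))
  refine div_le_div₀ ?_ ?_ hs0 a3
  · have := mul_nonneg (sub_nonneg.2 h1) (norm_nonneg (x - y))
    positivity
  · linarith

lemma dist_latFlow_le (h0 : 0 < θ) (h1 : θ ≤ 1) :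
    dist (latFlow d N θ x) (latFlow d N θ y) ≤
      (1 + n * (16 * n + 4)) / latScale d N θ x * dist x y := by
  have hs0 := latScale_pos (d := d) (N := N) (x := x) h0 h1
  have hs1 := latScale_le_one (d := d) (N := N) (x := x) h1
  have h := norm_latFlow_sub_sub_le (d := d) (N := N) (x := x) (y := y) h0 h1
  rw [dist_eq_norm, dist_eq_norm]
  have e : latFlow d N θ x - latFlow d N θ y =
    (x - y) + ((latFlow d N θ x - x) - (latFlow d N θ y - y)) := by abel
  have e2 : (1 - θ) * (n * (16 * n + 4)) / latScale d N θ x ≤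
      n * (16 * n + 4) / latScale d N θ x := by
    have : (0 : ℝ) ≤ n * (16 * n + 4) := by positivity
    exact div_le_div_of_nonneg_right (by nlinarith [mul_nonneg h0.le this]) hs0.le
  have e3 : 1 ≤ 1 / latScale d N θ x := (one_le_div hs0).2 hs1
  calc _ ≤ ‖x - y‖ + (1 - θ) * (n * (16 * n + 4)) / latScale d N θ x * ‖x - y‖ := by
        rw [e]; exact (norm_add_le _ _).trans (by gcongr)
    _ ≤ 1 / latScale d N θ x * ‖x - y‖ + n * (16 * n + 4) / latScale d N θ x * ‖x - y‖ := by
        gcongr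
        exact le_mul_of_one_le_left (norm_nonneg _) e3
    _ = _ := by ring

end latMin

section deform

variable {n : ℕ} {c : Euc n} {r ρ : ℝ}

/-- A Lipschitz perturbation of the identity is a homeomorphism. -/
lemma exists_homeomorph_id_add {g : Euc n → Euc n} {κ : ℝ≥0} (hκ : κ < 1)
    (hg : LipschitzWith κ g) : ∃ e : Euc n ≃ₜ Euc n, ∀ x, e x = x + g x := by
  have happ : ApproximatesLinearOn (fun x => x + g x)
      ((ContinuousLinearEquiv.refl ℝ (Euc n) : Euc n ≃L[ℝ] Euc n) : Euc n →L[ℝ] Euc n) univ κ := by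
    intro x _ y _
    have := hg.dist_le_mul x y
    rw [dist_eq_norm, dist_eq_norm] at this
    change ‖x + g x - (y + g y) - (x - y)‖ ≤ _
    rwa [show x + g x - (y + g y) - (x - y) = g x - g y by abel]
  refine ⟨ApproximatesLinearOn.toHomeomorph _ happ ?_, fun x => rfl⟩
  rcases subsingleton_or_nontrivial (Euc n) with h | h
  · exact Or.inl h
  · right
    have : ‖((ContinuousLinearEquiv.refl ℝ (Euc n)).symm : Euc n →L[ℝ] Euc n)‖₊ = 1 := by
      rw [← NNReal.coe_inj, coe_nnnorm]
      exact ContinuousLinearMap.norm_id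
    rw [this, inv_one]; exact hκ

lemma isDiffeo_id_add {g : Euc n → Euc n} {κ : ℝ≥0} (hκ : κ < 1)
    (hg : LipschitzWith κ g) (hs : ContDiff ℝ (⊤ : ℕ∞) g) : IsDiffeo fun x => x + g x := by
  obtain ⟨e, he⟩ := exists_homeomorph_id_add hκ hg
  have hsm : ContDiff ℝ (⊤ : ℕ∞) fun x => x + g x := contDiff_id.add hs
  have hlt : ∀ a, ‖-fderiv ℝ g a‖ < 1 := fun a => by
    rw [norm_neg]
    exact (norm_fderiv_le_of_lipschitz ℝ hg).trans_lt (by exact_mod_cast hκ)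
  have heq : ⇑e = fun x => x + g x := funext he
  refine ⟨hsm, e.symm, ?_, ?_, ?_⟩
  · refine e.contDiff_symm
      (f₀' := fun a => ContinuousLinearEquiv.ofUnit (Units.oneSub (-fderiv ℝ g a) (hlt a)))
      (fun a => ?_) (heq ▸ hsm)
    rw [heq]
    have h1 : HasFDerivAt g (fderiv ℝ g a) a :=
      (hs.differentiable (by simp)).differentiableAt.hasFDerivAt
    have h2 : ((ContinuousLinearEquiv.ofUnit (Units.oneSub (-fderiv ℝ g a) (hlt a)) :
        Euc n ≃L[ℝ] Euc n) : Euc n →L[ℝ] Euc n) =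
        ContinuousLinearMap.id ℝ (Euc n) + fderiv ℝ g a := by
      ext1 v
      change ((1 : Euc n →L[ℝ] Euc n) - -fderiv ℝ g a) v = _
      rw [sub_neg_eq_add]; rfl
    rw [h2]
    exact (hasFDerivAt_id a).add h1
  · rw [← heq]; exact e.symm_apply_apply
  · rw [← heq]; exact e.apply_symm_apply

lemma mem_deformClass_iff {φ : Euc n → Euc n} : φ ∈ DeformClass c r ↔
    (∃ C : ℝ≥0, LipschitzWith C φ) ∧
      ∀ ε > 0, ∃ ψ ∈ IsotopyClass c r, ∀ x, dist (φ x) (ψ x) < ε := by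
  constructor
  · rintro ⟨h1, ψ, h2, h3⟩
    refine ⟨h1, fun ε hε => ?_⟩
    obtain ⟨j, hj⟩ := ((Metric.tendstoUniformly_iff.1 h3) ε hε).exists
    exact ⟨ψ j, h2 j, hj⟩
  · rintro ⟨h1, h2⟩
    choose ψ hψ hd using fun j : ℕ => h2 (1 / ((j : ℝ) + 1)) (by positivity)
    refine ⟨h1, ψ, hψ, Metric.tendstoUniformly_iff.2 fun ε hε => ?_⟩
    have := (tendsto_one_div_add_atTop_nhds_zero_nat (𝕜 := ℝ)).eventually (gt_mem_nhds hε)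
    filter_upwards [this] with j hj x
    exact (hd j x).trans hj

lemma DeformClass.of_forall_exists {φ : Euc n → Euc n} {C : ℝ≥0} (h : LipschitzWith C φ)
    (h' : ∀ ε > 0, ∃ ψ ∈ DeformClass c r, ∀ x, dist (φ x) (ψ x) < ε) : φ ∈ DeformClass c r := by
  refine mem_deformClass_iff.2 ⟨⟨C, h⟩, fun ε hε => ?_⟩
  obtain ⟨ψ, hψ, hd⟩ := h' (ε / 2) (half_pos hε)
  obtain ⟨χ, hχ, hd'⟩ := (mem_deformClass_iff.1 hψ).2 (ε / 2) (half_pos hε)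
  refine ⟨χ, hχ, fun x => ?_⟩
  linarith [dist_triangle (φ x) (ψ x) (χ x), hd x, hd' x]

lemma IsotopyClass.comp {φ ψ : Euc n → Euc n} (hφ : φ ∈ IsotopyClass c r)
    (hψ : ψ ∈ IsotopyClass c r) : φ ∘ ψ ∈ IsotopyClass c r := by
  obtain ⟨f1, l, hl, l0, l1, l2, l3⟩ := hφ
  obtain ⟨g1, m, hm, m0, m1, m2, m3⟩ := hψ
  refine ⟨fun z hz => by rw [Function.comp_apply, g1 z hz, f1 z hz],
    fun t => l t ∘ m t, hl.comp (contDiff_fst.prodMk hm), by simp [l0, m0], by simp [l1, m1],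
    fun t ht z hz => by
      change l t (m t z) = z
      rw [m2 t ht z hz, l2 t ht z hz], fun t ht => ?_⟩
  obtain ⟨a1, a, a2, a3, a4⟩ := l3 t ht
  obtain ⟨b1, b, b2, b3, b4⟩ := m3 t ht
  exact ⟨a1.comp b1, b ∘ a, b2.comp a2, a3.comp b3, a4.comp b4⟩

lemma DeformClass.comp {φ ψ : Euc n → Euc n} (hφ : φ ∈ DeformClass c r)
    (hψ : ψ ∈ DeformClass c r) : φ ∘ ψ ∈ DeformClass c r := by
  obtain ⟨⟨C, hC⟩, h1⟩ := mem_deformClass_iff.1 hφ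
  obtain ⟨⟨D, hD⟩, h2⟩ := mem_deformClass_iff.1 hψ
  refine mem_deformClass_iff.2 ⟨⟨_, hC.comp hD⟩, fun ε hε => ?_⟩
  obtain ⟨φ', hφ', hd⟩ := h1 (ε / 2) (half_pos hε)
  obtain ⟨ψ', hψ', hd'⟩ := h2 (ε / 2 / (C + 1)) (by positivity)
  refine ⟨φ' ∘ ψ', IsotopyClass.comp hφ' hψ', fun x => ?_⟩
  have e1 : dist (φ (ψ x)) (φ (ψ' x)) ≤ ε / 2 := by
    refine (hC.dist_le_mul _ _).trans ?_
    calc (C : ℝ) * dist (ψ x) (ψ' x) ≤ (C + 1) * (ε / 2 / (C + 1)) := by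
          gcongr
          · linarith
          · exact (hd' x).le
      _ = ε / 2 := by field_simp
  have := dist_triangle (φ (ψ x)) (φ (ψ' x)) (φ' (ψ' x))
  have := hd (ψ' x)
  simp only [Function.comp_apply]
  linarith

lemma IsotopyClass.id_mem : id ∈ IsotopyClass c r :=
  ⟨fun _ _ => rfl, fun _ => id, contDiff_snd, rfl, rfl, fun _ _ _ _ => rfl,
    fun _ _ => ⟨contDiff_id, id, contDiff_id, fun _ => rfl, fun _ => rfl⟩⟩

lemma DeformClass.id_mem : id ∈ DeformClass c r :=
  mem_deformClass_iff.2 ⟨⟨1, LipschitzWith.id⟩, fun ε hε => ⟨id, IsotopyClass.id_mem, by simpa⟩⟩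

lemma DeformClass.iterate {φ : Euc n → Euc n} (h : φ ∈ DeformClass c r) (k : ℕ) :
    φ^[k] ∈ DeformClass c r := by
  induction k with
  | zero => exact DeformClass.id_mem
  | succ k ih => rw [Function.iterate_succ]; exact DeformClass.comp ih h

/-- Mollification of a compactly supported Lipschitz map. -/
lemma exists_contDiff_approx {g : Euc n → Euc n} {κ : ℝ≥0} (hg : LipschitzWith κ g)
    (h0 : ∀ x, ρ < dist x c → g x = 0) {ε : ℝ} (hε : 0 < ε) :
    ∃ f : Euc n → Euc n, ContDiff ℝ (⊤ : ℕ∞) f ∧ LipschitzWith κ f ∧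
      (∀ x, ρ + ε ≤ dist x c → f x = 0) ∧ ∀ x, dist (f x) (g x) ≤ κ * ε := by
  let φ : ContDiffBump (0 : Euc n) := ⟨ε / 2, ε, half_pos hε, half_lt_self hε⟩
  let w := φ.normed (volume : Measure (Euc n))
  have hwc : Continuous w := φ.contDiff_normed (n := 0) |>.continuous
  have hws : HasCompactSupport w := φ.hasCompactSupport_normed
  let f := convolution w g (ContinuousLinearMap.lsmul ℝ ℝ) volume
  have hex : ConvolutionExists w g (ContinuousLinearMap.lsmul ℝ ℝ) volume :=
    hws.convolutionExists_left _ hwc hg.continuous.locallyIntegrable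
  have hf : ∀ x, f x = ∫ t, w t • g (x - t) := fun x => rfl
  have hi : ∀ x, Integrable fun t => w t • g (x - t) := fun x => hex x
  have hw1 : Integrable w := hwc.integrable_of_hasCompactSupport hws
  refine ⟨f, hws.contDiff_convolution_left _ φ.contDiff_normed hg.continuous.locallyIntegrable,
    LipschitzWith.of_dist_le_mul fun x y => ?_, fun x hx => ?_, fun x => ?_⟩
  · rw [dist_eq_norm, hf, hf, ← integral_sub (hi x) (hi y)]
    refine (norm_integral_le_of_norm_le (hw1.mul_const (κ * dist x y))
      (ae_of_all _ fun t => ?_)).trans ?_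
    · rw [← smul_sub, norm_smul, Real.norm_of_nonneg (φ.nonneg_normed t)]
      refine mul_le_mul_of_nonneg_left ?_ (φ.nonneg_normed t)
      have := hg.dist_le_mul (x - t) (y - t)
      rwa [dist_eq_norm, dist_sub_right] at this
    · rw [integral_mul_const, φ.integral_normed, one_mul]
  · rw [hf]
    refine integral_eq_zero_of_ae (ae_of_all _ fun t => ?_)
    by_cases ht : dist t 0 < ε
    · have : dist x c ≤ dist (x - t) c + dist t 0 := by
        rw [dist_eq_norm, dist_eq_norm, dist_zero_right]
        refine le_trans (le_of_eq ?_) (norm_add_le _ _)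
        congr 1; abel
      simp [h0 (x - t) (by linarith)]
    · have : w t = 0 := by
        rw [← Function.notMem_support, φ.support_normed_eq]
        exact ht
      simp [this]
  · refine ContDiffBump.dist_normed_convolution_le hg.continuous.aestronglyMeasurable
      fun y hy => ?_
    refine (hg.dist_le_mul _ _).trans ?_
    gcongr
    exact (mem_ball.1 hy).le

/-- Small Lipschitz perturbations of the identity are admissible deformations. -/
lemma DeformClass.id_add {g : Euc n → Euc n} {κ : ℝ≥0} (hκ : κ < 1) (hg : LipschitzWith κ g)
    (hρ : ρ < r) (h0 : ∀ x, ρ < dist x c → g x = 0) : (fun x => x + g x) ∈ DeformClass c r := by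
  refine mem_deformClass_iff.2 ⟨⟨_, LipschitzWith.id.add hg⟩, fun ε hε => ?_⟩
  obtain ⟨f, f1, f2, f3, f4⟩ := exists_contDiff_approx hg h0 (lt_min (half_pos hε) (sub_pos.2 hρ))
  have f3' : ∀ x ∉ ball c r, f x = 0 := fun x hx => f3 x (by
    have := min_le_right (ε / 2) (r - ρ)
    have hx' : r ≤ dist x c := not_lt.1 hx
    linarith)
  refine ⟨fun x => x + f x, ⟨fun z hz => by simp [f3' z hz], fun t x => x + t • f x,
    contDiff_snd.add (contDiff_fst.smul (f1.comp contDiff_snd)), by ext; simp, by ext; simp,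
    fun t _ z hz => by simp [f3' z hz], fun t ht => ?_⟩, fun x => ?_⟩
  · refine isDiffeo_id_add hκ (LipschitzWith.of_dist_le_mul fun x y => ?_) (f1.const_smul t)
    rw [dist_smul₀, Real.norm_of_nonneg ht.1]
    exact (mul_le_of_le_one_left dist_nonneg ht.2).trans (f2.dist_le_mul x y)
  · rw [dist_add_left, dist_comm]
    refine (f4 x).trans_lt ?_
    have h1 : (κ : ℝ) < 1 := by exact_mod_cast hκ
    have h2 := min_le_left (ε / 2) (r - ρ)
    have h3 := lt_min (half_pos hε) (sub_pos.2 hρ)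
    nlinarith [κ.2]

/-- Homothety of a deformation. -/
lemma DeformClass.homothety {φ : Euc n → Euc n} (hφ : φ ∈ DeformClass c r) (p : Euc n) {ε : ℝ}
    (hε : 0 < ε) : (fun x => p + ε • φ (ε⁻¹ • (x - p))) ∈ DeformClass (p + ε • c) (ε * r) := by
  have hout : ∀ z ∉ ball (p + ε • c) (ε * r), ε⁻¹ • (z - p) ∉ ball c r := by
    intro z hz h
    apply hz
    rw [mem_ball] at h ⊢
    have : z = p + ε • (ε⁻¹ • (z - p)) := by rw [smul_inv_smul₀ hε.ne']; abel
    rw [this, dist_add_left, dist_smul₀, Real.norm_of_nonneg hε.le]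
    exact mul_lt_mul_of_pos_left h hε
  have hback : ∀ z, p + ε • (ε⁻¹ • (z - p)) = z := fun z => by
    rw [smul_inv_smul₀ hε.ne']; abel
  have hback' : ∀ z, ε⁻¹ • (p + ε • z - p) = z := fun z => by
    rw [add_sub_cancel_left, inv_smul_smul₀ hε.ne']
  have hA : ContDiff ℝ (⊤ : ℕ∞) fun z : Euc n => p + ε • z :=
    contDiff_const.add (contDiff_id.const_smul ε)
  have hB : ContDiff ℝ (⊤ : ℕ∞) fun z : Euc n => ε⁻¹ • (z - p) :=
    (contDiff_id.sub contDiff_const).const_smul ε⁻¹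
  obtain ⟨⟨C, hC⟩, h⟩ := mem_deformClass_iff.1 hφ
  refine mem_deformClass_iff.2 ⟨⟨C, LipschitzWith.of_dist_le_mul fun x y => ?_⟩, fun δ hδ => ?_⟩
  · rw [dist_add_left, dist_smul₀, Real.norm_of_nonneg hε.le]
    have := hC.dist_le_mul (ε⁻¹ • (x - p)) (ε⁻¹ • (y - p))
    rw [dist_smul₀, dist_sub_right, Real.norm_of_nonneg (inv_nonneg.2 hε.le)] at this
    calc _ ≤ ε * (C * (ε⁻¹ * dist x y)) := by gcongr
      _ = _ := by field_simp
  obtain ⟨ψ, ⟨f1, l, hl, l0, l1, l2, l3⟩, hd⟩ := h (δ / ε) (by positivity)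
  refine ⟨fun x => p + ε • ψ (ε⁻¹ • (x - p)), ⟨fun z hz => ?_, fun t x =>
    p + ε • l t (ε⁻¹ • (x - p)), ?_, ?_, ?_, fun t ht z hz => ?_, fun t ht => ?_⟩, fun x => ?_⟩
  · change p + ε • ψ (ε⁻¹ • (z - p)) = z
    rw [f1 _ (hout z hz), hback]
  · exact hA.comp (hl.comp (contDiff_fst.prodMk (hB.comp contDiff_snd)))
  · ext1 x
    change p + ε • l 0 (ε⁻¹ • (x - p)) = x
    rw [l0]; exact hback x
  · ext1 x
    change p + ε • l 1 (ε⁻¹ • (x - p)) = _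
    rw [l1]
  · change p + ε • l t (ε⁻¹ • (z - p)) = z
    rw [l2 t ht _ (hout z hz), hback]
  · obtain ⟨a1, a, a2, a3, a4⟩ := l3 t ht
    refine ⟨hA.comp (a1.comp hB), fun x => p + ε • a (ε⁻¹ • (x - p)), hA.comp (a2.comp hB),
      fun x => ?_, fun x => ?_⟩
    · simp only [hback']; rw [a3, hback]
    · simp only [hback']; rw [a4, hback]
  · rw [dist_add_left, dist_smul₀, Real.norm_of_nonneg hε.le]
    calc _ < ε * (δ / ε) := mul_lt_mul_of_pos_left (hd _) hε
      _ = δ := by field_simp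

/-- If `id + t g` stays bilipschitz for `t < 1` then `id + g` is an admissible deformation. -/
lemma DeformClass.id_add_of_antilipschitz {g : Euc n → Euc n} {K : ℝ≥0} (hg : LipschitzWith K g)
    (hρ : ρ < r) (h0 : ∀ x, ρ < dist x c → g x = 0)
    (hm : ∀ t : ℝ, 0 ≤ t → t < 1 → ∃ m : ℝ, 0 < m ∧ ∀ s, 0 ≤ s → s ≤ t → ∀ x y,
      m * dist x y ≤ dist (x + s • g x) (y + s • g y)) :
    (fun x => x + g x) ∈ DeformClass c r := by
  have hlt : ∀ t : ℝ, 0 ≤ t → t < 1 → (fun x => x + t • g x) ∈ DeformClass c r := by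
    intro t ht0 ht1
    obtain ⟨m, hm0, hm⟩ := hm t ht0 ht1
    obtain ⟨k, hk⟩ := exists_nat_gt ((K : ℝ) / m)
    have hk0 : (0 : ℝ) < k := lt_of_le_of_lt (by positivity) hk
    have main : ∀ i : ℕ, i ≤ k → (fun x => x + (i / k * t) • g x) ∈ DeformClass c r ∧
        Function.Surjective (fun x => x + (i / k * t) • g x) := by
      intro i
      induction i with
      | zero =>
        intro _
        simp only [Nat.cast_zero, zero_div, zero_mul, zero_smul, add_zero]
        exact ⟨DeformClass.id_mem, Function.surjective_id⟩
      | succ i ih =>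
        intro hi
        obtain ⟨ih1, ih2⟩ := ih (by omega)
        set s : ℝ := i / k * t with hs
        have hs' : ((i + 1 : ℕ) : ℝ) / k * t = s + t / k := by rw [hs]; push_cast; ring
        rw [hs']
        have hs0 : 0 ≤ s := by positivity
        have hst : s ≤ t := by
          refine mul_le_of_le_one_left ht0 ((div_le_one hk0).2 ?_)
          exact_mod_cast (by omega : i ≤ k)
        choose G hG using ih2
        have hGlip : ∀ y z, m * dist (G y) (G z) ≤ dist y z := fun y z => by
          have := hm s hs0 hst (G y) (G z)
          rwa [show G y + s • g (G y) = y from hG y, show G z + s • g (G z) = z from hG z] at this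
        have hleft : ∀ x, G (x + s • g x) = x := fun x => by
          have := hm s hs0 hst (G (x + s • g x)) x
          rw [show G (x + s • g x) + s • g (G (x + s • g x)) = _ from hG (x + s • g x),
            dist_self] at this
          exact dist_le_zero.1 (by nlinarith [dist_nonneg (x := G (x + s • g x)) (y := x)])
        let κ : ℝ≥0 := ⟨t / k * (K / m), by positivity⟩
        have hκ : κ < 1 := by
          rw [← NNReal.coe_lt_coe]
          change t / k * (K / m) < 1
          rw [div_mul_eq_mul_div, div_lt_one hk0]
          have : (0 : ℝ) ≤ K / m := by positivity
          nlinarith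
        have hlip : LipschitzWith κ fun y => (t / k) • g (G y) := by
          refine LipschitzWith.of_dist_le_mul fun y z => ?_
          change _ ≤ t / k * (K / m) * dist y z
          rw [dist_smul₀, Real.norm_of_nonneg (by positivity), mul_assoc]
          refine mul_le_mul_of_nonneg_left ((hg.dist_le_mul _ _).trans ?_) (by positivity)
          rw [div_mul_eq_mul_div, mul_div_assoc]
          refine mul_le_mul_of_nonneg_left ?_ K.2
          rw [le_div_iff₀ hm0, mul_comm]
          exact hGlip y z
        have hz : ∀ x, ρ < dist x c → (t / k) • g (G x) = 0 := fun x hx => by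
          have : G x = x := by
            conv_rhs => rw [← hleft x]
            rw [h0 x hx, smul_zero, add_zero]
          rw [this, h0 x hx, smul_zero]
        have hcomp : (fun x => x + (s + t / k) • g x) =
            (fun y => y + (t / k) • g (G y)) ∘ fun x => x + s • g x := by
          ext1 x
          simp only [Function.comp_apply, hleft, add_smul]; abel
        rw [hcomp]
        refine ⟨DeformClass.comp (DeformClass.id_add hκ hlip hρ hz) ih1, ?_⟩
        obtain ⟨e, he⟩ := exists_homeomorph_id_add hκ hlip
        refine Function.Surjective.comp ?_ fun y => ⟨G y, hG y⟩
        intro y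
        exact ⟨e.symm y, (he _).symm.trans (e.apply_symm_apply y)⟩
    have := (main k le_rfl).1
    rwa [div_self hk0.ne', one_mul] at this
  refine DeformClass.of_forall_exists (LipschitzWith.id.add hg) fun ε hε => ?_
  obtain ⟨B, hB⟩ :=
    (isCompact_closedBall c ρ).exists_bound_of_continuousOn hg.continuous.continuousOn
  have hB' : ∀ x, ‖g x‖ ≤ max B 0 := fun x => by
    rcases le_or_gt (dist x c) ρ with h | h
    · exact (hB x h).trans (le_max_left _ _)
    · rw [h0 x h, norm_zero]; exact le_max_right _ _
  have hM : 0 < max B 0 + 1 := by positivity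
  set t := max 0 (1 - ε / 2 / (max B 0 + 1)) with ht
  have h1 : 0 < ε / 2 / (max B 0 + 1) := by positivity
  have ht1 : t < 1 := max_lt zero_lt_one (by linarith)
  have ht2 : 1 - t ≤ ε / 2 / (max B 0 + 1) := by
    have := le_max_right 0 (1 - ε / 2 / (max B 0 + 1))
    linarith
  refine ⟨_, hlt t (le_max_left _ _) ht1, fun x => ?_⟩
  rw [dist_add_left, dist_eq_norm, show g x - t • g x = (1 - t) • g x by rw [sub_smul, one_smul],
    norm_smul, Real.norm_of_nonneg (by linarith)]
  calc (1 - t) * ‖g x‖ ≤ ε / 2 / (max B 0 + 1) * (max B 0 + 1) := by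
        gcongr
        exact (hB' x).trans (by linarith)
    _ = ε / 2 := by field_simp
    _ < ε := half_lt_self hε

end deform

lemma latFlow_iterate {n d N : ℕ} {θ : ℝ} (h0 : 0 < θ) (h1 : θ ≤ 1) (k : ℕ) :
    latFlow (n := n) d N (θ ^ k) = (latFlow d N θ)^[k] := by
  induction k with
  | zero =>
    ext x i
    simp [latScale, logDisp]
  | succ k ih =>
    rw [Function.iterate_succ, ← ih]
    ext1 x
    rw [Function.comp_apply, latFlow_comp h0 h1 (pow_pos h0 k) (pow_le_one₀ h0.le h1), pow_succ']

lemma exists_latFlow_mem_deformClass {n : ℕ} (d N : ℕ) {c : Euc n} {r ρ θ : ℝ} (hθ : 0 < θ)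
    (hρ : ρ < r) (hc : ∀ x : Euc n, (∀ j, |x j| ≤ N + 1 / 4) → dist x c ≤ ρ) :
    ∃ τ, 0 < τ ∧ τ ≤ θ ∧ τ ≤ 1 ∧ latFlow d N τ ∈ DeformClass c r := by
  set A : ℝ := n * (16 * n + 4) with hA
  have hA0 : 0 ≤ A := by positivity
  set δ : ℝ := 1 / (2 * (2 * A + 1)) with hδ
  have hδ0 : 0 < δ := by positivity
  have hδ1 : δ ≤ 1 / 2 := by
    rw [hδ, div_le_div_iff₀ (by positivity) (by norm_num)]; linarith
  have hδA : 2 * δ * A < 1 := by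
    rw [hδ, mul_one_div, div_mul_eq_mul_div, div_lt_one (by positivity)]; linarith
  have h0 : 0 < 1 - δ := by linarith
  have h1 : 1 - δ ≤ 1 := by linarith
  obtain ⟨k, hk⟩ := exists_pow_lt_of_lt_one hθ (show 1 - δ < 1 by linarith)
  refine ⟨(1 - δ) ^ k, pow_pos h0 k, hk.le, pow_le_one₀ h0.le h1, ?_⟩
  rw [latFlow_iterate h0 h1]
  refine DeformClass.iterate ?_ k
  have e : latFlow d N (1 - δ) = fun x : Euc n => x + (latFlow d N (1 - δ) x - x) := by
    ext1 x; abel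
  rw [e]
  let κ : ℝ≥0 := ⟨2 * δ * A, by positivity⟩
  have hκ : κ < 1 := NNReal.coe_lt_coe.1 (show 2 * δ * A < ((1 : ℝ≥0) : ℝ) from by simpa using hδA)
  refine DeformClass.id_add (κ := κ) hκ (LipschitzWith.of_dist_le_mul fun x y => ?_) hρ
    fun x hx => ?_
  · rw [dist_eq_norm, dist_eq_norm]
    refine (norm_latFlow_sub_sub_le h0 h1).trans ?_
    refine mul_le_mul_of_nonneg_right ?_ (norm_nonneg _)
    have hs : 1 / 2 ≤ latScale d N (1 - δ) x := le_trans (by linarith) (le_latScale h1)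
    change _ ≤ 2 * δ * A
    rw [div_le_iff₀ (by linarith), sub_sub_cancel]
    nlinarith [mul_nonneg hδ0.le hA0]
  · have : ∃ j, N + 1 / 4 < |x j| := by
      by_contra! hcon
      exact absurd (hc x hcon) (not_le.2 hx)
    obtain ⟨j, hj⟩ := this
    rw [latFlow_eq_self_of_le hj.le, sub_self]

/-- The displacement of the map pushing points away from the integers. -/
def pushDisp (lam t : ℝ) : ℝ :=
  max (-(1 / 2)) (min (1 / 2) (lam * (t - round t))) - (t - round t)

section push

variable {lam : ℝ}

lemma pushDisp_eq (hl : 1 ≤ lam) {t : ℝ} {c : ℤ} (h : |t - c| ≤ 1 / 2) :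
    pushDisp lam t = max (-(1 / 2)) (min (1 / 2) (lam * (t - c))) - (t - c) := by
  refine periodic_eq_of_abs_sub_le
    (ω := fun u => max (-(1 / 2)) (min (1 / 2) (lam * u)) - u) ?_ h
  rw [min_eq_left (by linarith), min_eq_right (by linarith), max_eq_right (by norm_num),
    max_eq_left (by linarith)]
  norm_num

lemma clamp_lipschitz (b s t : ℝ) : |max (-b) (min b s) - max (-b) (min b t)| ≤ |s - t| := by
  refine (abs_max_sub_max_le_max _ _ _ _).trans (max_le (by simp) ?_)
  exact (abs_min_sub_min_le_max _ _ _ _).trans (max_le (by simp) le_rfl)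

lemma pushDisp_lipschitz (hl : 1 ≤ lam) (s t : ℝ) :
    |pushDisp lam s - pushDisp lam t| ≤ (lam + 1) * |s - t| := by
  refine periodic_lipschitz (ω := fun u => max (-(1 / 2)) (min (1 / 2) (lam * u)) - u)
    (fun u v _ _ => ?_) ?_ ?_ s t
  · have h1 := clamp_lipschitz (1 / 2) (lam * u) (lam * v)
    rw [← mul_sub, abs_mul, abs_of_nonneg (by linarith : (0 : ℝ) ≤ lam)] at h1
    rw [sub_sub_sub_comm, add_mul, one_mul]
    exact (abs_sub _ _).trans (by gcongr)
  · rw [min_eq_left (by linarith), max_eq_right (by norm_num), sub_self]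
  · rw [min_eq_right (by linarith), max_eq_left (by linarith), sub_self]

lemma add_pushDisp_mono (hl : 1 ≤ lam) {s t : ℝ} (h : s ≤ t) :
    s + pushDisp lam s ≤ t + pushDisp lam t := by
  refine periodic_monotone (ω := fun u => max (-(1 / 2)) (min (1 / 2) (lam * u)) - u)
    (fun u v _ _ huv => ?_) ?_ ?_ h
  · rw [add_sub_cancel, add_sub_cancel]
    gcongr
  · rw [min_eq_left (by linarith), max_eq_right (by norm_num), sub_self]
  · rw [min_eq_right (by linarith), max_eq_left (by linarith), sub_self]

lemma pushDisp_half (hl : 1 ≤ lam) (z : ℤ) : pushDisp lam (z + 1 / 2) = 0 := by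
  rw [pushDisp_eq hl (c := z) (by rw [add_sub_cancel_left]; norm_num),
    add_sub_cancel_left, min_eq_left (by linarith), max_eq_right (by norm_num), sub_self]

lemma abs_pushDisp_le (t : ℝ) : |pushDisp lam t| ≤ 1 := by
  have h1 := abs_le.1 (abs_sub_round t)
  have h2 := le_max_left (-(1 / 2)) (min (1 / 2) (lam * (t - round t)))
  have h3 : max (-(1 / 2)) (min (1 / 2) (lam * (t - round t))) ≤ 1 / 2 :=
    max_le (by norm_num) (min_le_left _ _)
  rw [pushDisp, abs_le]
  constructor <;> linarith

lemma exists_add_pushDisp_eq {t : ℝ} (hl : 1 ≤ lam) (h : 1 / (2 * lam) ≤ cellDist t) :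
    ∃ z : ℤ, t + pushDisp lam t = z + 1 / 2 := by
  have hl0 : 0 < 2 * lam := by linarith
  rw [div_le_iff₀ hl0, cellDist] at h
  rcases le_total 0 (t - round t) with h0 | h0
  · rw [abs_of_nonneg h0] at h
    refine ⟨round t, ?_⟩
    rw [pushDisp, min_eq_left (by linarith), max_eq_right (by norm_num)]; ring
  · rw [abs_of_nonpos h0] at h
    refine ⟨round t - 1, ?_⟩
    rw [pushDisp, min_eq_right (by linarith), max_eq_left (by linarith)]; push_cast; ring

/-- The function `pushDisp`, cut off outside `[-(N + 3/2), N + 3/2]`. -/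
def pushCut (N : ℕ) (lam t : ℝ) : ℝ :=
  pushDisp lam (max (-(N + 3 / 2)) (min (N + 3 / 2) t))

variable {N : ℕ}

lemma pushCut_of_le {t : ℝ} (h : |t| ≤ N + 3 / 2) : pushCut N lam t = pushDisp lam t := by
  rw [abs_le] at h
  rw [pushCut, min_eq_right h.2, max_eq_right h.1]

lemma pushCut_of_ge (hl : 1 ≤ lam) {t : ℝ} (h : N + 3 / 2 ≤ |t|) : pushCut N lam t = 0 := by
  have hN : (0 : ℝ) ≤ N := Nat.cast_nonneg N
  rcases le_total 0 t with h0 | h0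
  · rw [abs_of_nonneg h0] at h
    rw [pushCut, min_eq_left h, max_eq_right (by linarith)]
    convert pushDisp_half hl (N + 1) using 2
    push_cast; ring
  · rw [abs_of_nonpos h0] at h
    rw [pushCut, min_eq_right (by linarith), max_eq_left (by linarith)]
    convert pushDisp_half hl (-N - 2) using 2
    push_cast; ring

lemma pushCut_lipschitz (hl : 1 ≤ lam) (s t : ℝ) :
    |pushCut N lam s - pushCut N lam t| ≤ (lam + 1) * |s - t| :=
  (pushDisp_lipschitz hl _ _).trans
    (mul_le_mul_of_nonneg_left (clamp_lipschitz _ _ _) (by linarith))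

lemma add_mul_pushCut_mono (hl : 1 ≤ lam) {χ s t : ℝ} (h0 : 0 ≤ χ) (h1 : χ ≤ 1) (h : s ≤ t) :
    s + χ * pushCut N lam s ≤ t + χ * pushCut N lam t := by
  set b : ℝ := N + 3 / 2 with hb
  have e1 : max (-b) (min b s) ≤ max (-b) (min b t) := by gcongr
  have e2 := add_pushDisp_mono hl e1
  have e3 := (le_abs_self _).trans (clamp_lipschitz b t s)
  rw [abs_of_nonneg (sub_nonneg.2 h)] at e3
  have e4 := mul_le_mul_of_nonneg_left e2 h0
  have e5 := mul_le_mul_of_nonneg_left e1 (sub_nonneg.2 h1)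
  unfold pushCut
  linarith

/-- Cutoff in the coordinates other than `i`. -/
def sideCut {n : ℕ} (N : ℕ) (i : Fin n) (x : Euc n) : ℝ :=
  max 0 (1 - ∑ j ∈ Finset.univ.erase i, max 0 (|x j| - (N + 1)))

variable {n : ℕ} {x y : Euc n} {i j : Fin n}

lemma sideCut_nonneg : 0 ≤ sideCut N i x := le_max_left _ _

lemma sideCut_le_one : sideCut N i x ≤ 1 := by
  have : 0 ≤ ∑ j ∈ Finset.univ.erase i, max 0 (|x j| - (N + 1)) :=
    Finset.sum_nonneg fun _ _ => le_max_left _ _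
  exact max_le zero_le_one (by linarith)

lemma sideCut_eq_one (h : ∀ j, |x j| ≤ N + 1) : sideCut N i x = 1 := by
  rw [sideCut, Finset.sum_eq_zero fun j _ => max_eq_left (by linarith [h j])]
  simp

lemma sideCut_eq_zero (hij : j ≠ i) (h : N + 2 ≤ |x j|) : sideCut N i x = 0 := by
  have := Finset.single_le_sum (f := fun j => max 0 (|x j| - (N + 1)))
    (fun _ _ => le_max_left _ _) (Finset.mem_erase.2 ⟨hij, Finset.mem_univ j⟩)
  have h2 := le_max_right 0 (|x j| - (N + 1))
  exact max_eq_left (by linarith)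

lemma abs_sideCut_sub_le {B : ℝ} (hB : 0 ≤ B) (h : ∀ j ≠ i, |x j - y j| ≤ B) :
    |sideCut N i x - sideCut N i y| ≤ n * B := by
  refine (abs_max_sub_max_le_max _ _ _ _).trans (max_le ?_ ?_)
  · rw [sub_self, abs_zero]; positivity
  rw [sub_sub_sub_cancel_left, ← Finset.sum_sub_distrib]
  refine (Finset.abs_sum_le_sum_abs _ _).trans ?_
  refine (Finset.sum_le_sum (g := fun _ => B) fun j hj => ?_).trans ?_
  · refine (abs_max_sub_max_le_max _ _ _ _).trans (max_le (by simpa) ?_)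
    rw [sub_sub_sub_cancel_right]
    refine (abs_abs_sub_abs_le_abs_sub _ _).trans ?_
    rw [abs_sub_comm]
    exact h j (Finset.ne_of_mem_erase hj)
  · rw [Finset.sum_const, nsmul_eq_mul]
    gcongr
    exact (Finset.card_le_univ _).trans_eq (Fintype.card_fin n)

/-- The displacement of the collapse in direction `i`. -/
def pushVec {n : ℕ} (N : ℕ) (lam : ℝ) (i : Fin n) (x : Euc n) : Euc n :=
  EuclideanSpace.single i (sideCut N i x * pushCut N lam (x i))

lemma pushVec_apply_self : pushVec N lam i x i = sideCut N i x * pushCut N lam (x i) := by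
  simp [pushVec]

lemma pushVec_apply_ne (h : j ≠ i) : pushVec N lam i x j = 0 := by
  simp [pushVec, h]

lemma abs_pushCut_le (t : ℝ) : |pushCut N lam t| ≤ 1 := abs_pushDisp_le _

lemma pushVec_lipschitz (hl : 1 ≤ lam) :
    LipschitzWith (Real.toNNReal (n + lam + 1)) (pushVec (n := n) N lam i) := by
  refine LipschitzWith.of_dist_le_mul fun x y => ?_
  rw [Real.coe_toNNReal _ (by positivity), pushVec, pushVec, PiLp.dist_single_same,
    Real.dist_eq, dist_eq_norm]
  have h1 := abs_sideCut_sub_le (N := N) (i := i) (norm_nonneg (x - y))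
    fun j _ => abs_sub_apply_le x y j
  have h2 := (pushCut_lipschitz (N := N) hl (x i) (y i)).trans
    (mul_le_mul_of_nonneg_left (abs_sub_apply_le x y i) (by linarith))
  have e : sideCut N i x * pushCut N lam (x i) - sideCut N i y * pushCut N lam (y i)
      = (sideCut N i x - sideCut N i y) * pushCut N lam (x i)
        + sideCut N i y * (pushCut N lam (x i) - pushCut N lam (y i)) := by ring
  rw [e]
  refine (abs_add_le _ _).trans ?_
  rw [abs_mul, abs_mul, abs_of_nonneg (sideCut_nonneg (x := y))]
  have h3 := mul_le_mul h1 (abs_pushCut_le (N := N) (lam := lam) (x i)) (abs_nonneg _)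
    (by positivity)
  have h4 := mul_le_mul (sideCut_le_one (N := N) (x := y) (i := i)) h2 (abs_nonneg _) zero_le_one
  linarith

/-- The collapse in direction `i` onto the hyperplanes `x i ∈ ℤ + 1/2`. -/
def pushMap {n : ℕ} (N : ℕ) (lam : ℝ) (i : Fin n) (x : Euc n) : Euc n := x + pushVec N lam i x

lemma pushMap_apply_self : pushMap N lam i x i = x i + sideCut N i x * pushCut N lam (x i) := by
  simp [pushMap, pushVec]

lemma pushMap_apply_ne (h : j ≠ i) : pushMap N lam i x j = x j := by
  simp [pushMap, pushVec, h]

lemma pushVec_eq_zero (hl : 1 ≤ lam) (h : N + 2 ≤ |x j|) : pushVec N lam i x = 0 := by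
  rw [pushVec, PiLp.single_eq_zero_iff, mul_eq_zero]
  by_cases hij : j = i
  · subst hij
    exact Or.inr (pushCut_of_ge hl (by linarith))
  · exact Or.inl (sideCut_eq_zero hij h)

lemma pushMap_eq_self (hl : 1 ≤ lam) (h : N + 2 ≤ |x j|) : pushMap N lam i x = x := by
  rw [pushMap, pushVec_eq_zero hl h, add_zero]

lemma pushMap_apply_self_of_le (h : ∀ j, |x j| ≤ N + 1 / 2) :
    pushMap N lam i x i = x i + pushDisp lam (x i) := by
  rw [pushMap_apply_self, sideCut_eq_one fun j => by linarith [h j],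
    pushCut_of_le (by linarith [h i]), one_mul]

lemma abs_pushMap_le (hl : 1 ≤ lam) (h : ∀ j, |x j| ≤ N + 1 / 2) (j : Fin n) :
    |pushMap N lam i x j| ≤ N + 1 / 2 := by
  by_cases hj : j = i
  · subst hj
    rw [pushMap_apply_self_of_le h, abs_le]
    have h1 := abs_le.1 (h j)
    have h2 := add_pushDisp_mono hl h1.1
    have h3 := add_pushDisp_mono hl h1.2
    have h4 := pushDisp_half hl N
    have h5 := pushDisp_half hl (-N - 1)
    push_cast at h4 h5
    rw [h4] at h3
    rw [show -((N : ℝ) + 1 / 2) = -N - 1 + 1 / 2 by ring, h5] at h2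
    constructor <;> linarith
  · rw [pushMap_apply_ne hj]; exact h j

lemma pushMap_antilipschitz (hl : 1 ≤ lam) {s t : ℝ} (hs : 0 ≤ s) (hst : s ≤ t) (ht : t < 1)
    (x y : Euc n) :
    (1 - t) / (n * (n + 1) + 1) * dist x y
      ≤ dist (x + s • pushVec N lam i x) (y + s • pushVec N lam i y) := by
  set D := dist (x + s • pushVec N lam i x) (y + s • pushVec N lam i y) with hD
  have hD0 : 0 ≤ D := dist_nonneg
  have hne : ∀ j ≠ i, |x j - y j| ≤ D := fun j hj => by
    have := abs_sub_apply_le (x + s • pushVec N lam i x) (y + s • pushVec N lam i y) j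
    simpa [pushVec_apply_ne hj, ← dist_eq_norm] using this
  have hi := abs_sub_apply_le (x + s • pushVec N lam i x) (y + s • pushVec N lam i y) i
  rw [← dist_eq_norm, ← hD] at hi
  simp only [PiLp.add_apply, PiLp.smul_apply, pushVec_apply_self, smul_eq_mul] at hi
  have hc := abs_sideCut_sub_le (N := N) (i := i) hD0 hne
  have hn0 : (0 : ℝ) ≤ n := Nat.cast_nonneg n
  have key : ∀ χ χ' u v : ℝ, 0 ≤ χ → χ ≤ 1 → |χ - χ'| ≤ n * D → v ≤ u →
      |u + s * (χ * pushCut N lam u) - (v + s * (χ' * pushCut N lam v))| ≤ D →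
      (1 - t) * |u - v| ≤ (n + 1) * D := by
    intro χ χ' u v h0 h1 h2 huv h
    have m1 := mul_nonneg hs (sub_nonneg.2 (add_mul_pushCut_mono (N := N) hl h0 h1 huv))
    have m2 : |s * ((χ - χ') * pushCut N lam v)| ≤ 1 * (n * D * 1) := by
      rw [abs_mul, abs_mul, abs_of_nonneg hs]
      exact mul_le_mul (by linarith) (mul_le_mul h2 (abs_pushCut_le v) (abs_nonneg _)
        (by positivity)) (by positivity) zero_le_one
    have m3 := (abs_le.1 m2).1
    have m4 := (le_abs_self _).trans h
    have m5 := mul_le_mul_of_nonneg_right (sub_le_sub_left hst 1) (sub_nonneg.2 huv)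
    rw [abs_of_nonneg (sub_nonneg.2 huv)]
    linarith
  have hii : (1 - t) * |x i - y i| ≤ (n + 1) * D := by
    rcases le_total (y i) (x i) with h | h
    · exact key _ _ _ _ sideCut_nonneg sideCut_le_one hc h hi
    · rw [abs_sub_comm] at hi hc ⊢
      exact key _ _ _ _ sideCut_nonneg sideCut_le_one hc h hi
  have hall : ∀ j, |((1 - t) • (x - y)) j| ≤ (n + 1) * D := fun j => by
    rw [PiLp.smul_apply, smul_eq_mul, abs_mul, abs_of_nonneg (by linarith), PiLp.sub_apply]
    by_cases hj : j = i
    · rw [hj]; exact hii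
    · have := mul_le_mul (show 1 - t ≤ 1 by linarith) (hne j hj) (abs_nonneg _) zero_le_one
      nlinarith
  have := norm_le_card_mul hall
  rw [norm_smul, Real.norm_eq_abs, abs_of_nonneg (by linarith), ← dist_eq_norm] at this
  rw [div_mul_eq_mul_div, div_le_iff₀ (by positivity)]
  linarith

lemma pushMap_mem_deformClass (hl : 1 ≤ lam) {c : Euc n} {r ρ : ℝ} (hρ : ρ < r)
    (hc : ∀ x : Euc n, (∀ j, |x j| ≤ N + 2) → dist x c ≤ ρ) :
    pushMap N lam i ∈ DeformClass c r := by
  refine DeformClass.id_add_of_antilipschitz (pushVec_lipschitz hl) hρ (fun x hx => ?_)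
    fun t _ ht => ⟨(1 - t) / (n * (n + 1) + 1), div_pos (by linarith) (by positivity),
      fun s hs hst x y => pushMap_antilipschitz hl hs hst ht x y⟩
  have : ∃ j, N + 2 < |x j| := by
    by_contra! hcon
    exact absurd (hc x hcon) (not_le.2 hx)
  obtain ⟨j, hj⟩ := this
  exact pushVec_eq_zero hl hj.le

/-- Successive collapse in the directions of a list. -/
def collapse {n : ℕ} (N : ℕ) (lam : ℝ) : List (Fin n) → Euc n → Euc n
  | [] => id
  | i :: l => pushMap N lam i ∘ collapse N lam l

lemma collapse_mem_deformClass (hl : 1 ≤ lam) {c : Euc n} {r ρ : ℝ} (hρ : ρ < r)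
    (hc : ∀ x : Euc n, (∀ j, |x j| ≤ N + 2) → dist x c ≤ ρ) (l : List (Fin n)) :
    collapse N lam l ∈ DeformClass c r := by
  induction l with
  | nil => exact DeformClass.id_mem
  | cons i l ih => exact DeformClass.comp (pushMap_mem_deformClass hl hρ hc) ih

lemma collapse_lipschitz (hl : 1 ≤ lam) (l : List (Fin n)) :
    LipschitzWith ((1 + Real.toNNReal (n + lam + 1)) ^ l.length)
      (collapse (n := n) N lam l) := by
  induction l with
  | nil => exact LipschitzWith.id
  | cons i l ih =>
    rw [List.length_cons, pow_succ']
    exact (LipschitzWith.id.add (pushVec_lipschitz hl)).comp ih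

lemma collapse_eq_self (hl : 1 ≤ lam) (h : N + 2 ≤ |x j|) (l : List (Fin n)) :
    collapse N lam l x = x := by
  induction l with
  | nil => rfl
  | cons i l ih => rw [collapse, Function.comp_apply, ih, pushMap_eq_self hl h]

lemma abs_collapse_le (hl : 1 ≤ lam) (h : ∀ j, |x j| ≤ N + 1 / 2) (l : List (Fin n)) (j : Fin n) :
    |collapse N lam l x j| ≤ N + 1 / 2 := by
  induction l generalizing j with
  | nil => exact h j
  | cons i l ih => exact abs_pushMap_le hl ih j

lemma exists_collapse_apply_eq (hl : 1 ≤ lam) (h : ∀ j, |x j| ≤ N + 1 / 2)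
    (hj : 1 / (2 * lam) ≤ cellDist (x j)) (l : List (Fin n)) :
    (j ∉ l → collapse N lam l x j = x j) ∧
      (j ∈ l → ∃ z : ℤ, collapse N lam l x j = z + 1 / 2) := by
  induction l with
  | nil => simp [collapse]
  | cons i l ih =>
    have hle := abs_collapse_le hl h l
    rw [collapse, Function.comp_apply]
    by_cases hi : j = i
    · subst hi
      refine ⟨fun hn => by simp at hn, fun _ => ?_⟩
      rw [pushMap_apply_self_of_le hle]
      by_cases hjl : j ∈ l
      · obtain ⟨z, hz⟩ := ih.2 hjl
        exact ⟨z, by rw [hz, pushDisp_half hl, add_zero]⟩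
      · rw [ih.1 hjl]
        exact exists_add_pushDisp_eq hl hj
    · rw [pushMap_apply_ne hi, List.mem_cons]
      simpa [hi] using ih

end push

lemma ofReal_one_div_rpow_mono {a b : ℝ} (hb : 0 < b) (hab : b ≤ a) {d : ℝ} (hd : 0 ≤ d) :
    ENNReal.ofReal (1 / a) ^ d ≤ ENNReal.ofReal (1 / b) ^ d :=
  ENNReal.rpow_le_rpow (ENNReal.ofReal_le_ofReal (one_div_le_one_div_of_le hb hab)) hd

lemma hausdorffMeasure_image_le_lintegral {X Y : Type*} [MetricSpace X] [MeasurableSpace X]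
    [BorelSpace X] [MetricSpace Y] [MeasurableSpace Y] [BorelSpace Y] {f : X → Y} {h : X → ℝ}
    {S : Set X} {C d : ℝ} (hC : 0 ≤ C) (hd : 0 ≤ d) (hS : MeasurableSet S) (hm : Measurable h)
    (h0 : ∀ x ∈ S, 0 < h x) (h1 : ∀ x ∈ S, h x ≤ 1)
    (hf : ∀ x ∈ S, ∀ y ∈ S, dist (f x) (f y) ≤ C / h x * dist x y) :
    μH[d] (f '' S) ≤
      ENNReal.ofReal (2 * C) ^ d * ∫⁻ x in S, ENNReal.ofReal (1 / h x) ^ d ∂μH[d] := by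
  set T : ℕ → Set X := fun k => S ∩ h ⁻¹' Ioc ((1 / 2) ^ (k + 1)) ((1 / 2) ^ k)
  have hTm : ∀ k, MeasurableSet (T k) := fun k => hS.inter (hm measurableSet_Ioc)
  have hdis : Pairwise (Function.onFun Disjoint T) := by
    have key : ∀ k l, k < l → Disjoint (T k) (T l) := fun k l hkl => by
      refine Set.disjoint_left.2 fun x hx hx' => ?_
      have : ((1 : ℝ) / 2) ^ l ≤ (1 / 2) ^ (k + 1) :=
        pow_le_pow_of_le_one (by norm_num) (by norm_num) hkl
      exact absurd (hx'.2.2.trans this) (not_le.2 hx.2.1)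
    intro k l hkl
    rcases lt_or_gt_of_ne hkl with h | h
    · exact key k l h
    · exact (key l k h).symm
  have hU : ⋃ k, T k = S := by
    refine Subset.antisymm (iUnion_subset fun k => inter_subset_left) fun x hx => ?_
    obtain ⟨k, hk⟩ := exists_nat_pow_near_of_lt_one (h0 x hx) (h1 x hx)
      (show (0 : ℝ) < 1 / 2 by norm_num) (by norm_num)
    exact mem_iUnion.2 ⟨k, hx, hk⟩
  have hk : ∀ k, μH[d] (f '' T k) ≤
      ENNReal.ofReal (2 * C) ^ d * ∫⁻ x in T k, ENNReal.ofReal (1 / h x) ^ d ∂μH[d] := fun k => by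
    have p0 : (0 : ℝ) < (1 / 2) ^ k := by positivity
    have p1 : (0 : ℝ) < (1 / 2) ^ (k + 1) := by positivity
    have hl : LipschitzOnWith (Real.toNNReal (2 * C * (1 / (1 / 2) ^ k))) f (T k) := by
      refine LipschitzOnWith.of_dist_le_mul fun x hx y hy => ?_
      rw [Real.coe_toNNReal _ (by positivity)]
      refine (hf x hx.1 y hy.1).trans (mul_le_mul_of_nonneg_right ?_ dist_nonneg)
      calc C / h x ≤ C / (1 / 2) ^ (k + 1) := div_le_div_of_nonneg_left hC p1 hx.2.1.le
        _ = _ := by rw [pow_succ]; field_simp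
    refine (hl.hausdorffMeasure_image_le hd).trans ?_
    change ENNReal.ofReal _ ^ d * _ ≤ _
    rw [ENNReal.ofReal_mul (by positivity), ENNReal.mul_rpow_of_nonneg _ _ hd, mul_assoc]
    refine mul_le_mul_right ?_ _
    rw [← setLIntegral_const]
    exact setLIntegral_mono' (hTm k) fun x hx =>
      ofReal_one_div_rpow_mono (h0 x hx.1) hx.2.2 hd
  calc μH[d] (f '' S) = μH[d] (⋃ k, f '' T k) := by rw [← image_iUnion, hU]
    _ ≤ ∑' k, μH[d] (f '' T k) := measure_iUnion_le _
    _ ≤ ∑' k, ENNReal.ofReal (2 * C) ^ d * ∫⁻ x in T k, ENNReal.ofReal (1 / h x) ^ d ∂μH[d] :=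
        ENNReal.tsum_le_tsum hk
    _ = _ := by rw [ENNReal.tsum_mul_left, ← lintegral_iUnion hTm hdis, hU]

lemma hausdorffMeasure_halfLattice_eq_zero (n d : ℕ) :
    μH[(d : ℝ)] {z : Euc n | ∀ I : Finset (Fin n), I.card = d → ∃ i ∈ I, ∃ m : ℤ,
      z i = m + 1 / 2} = 0 := by
  have hsub : {z : Euc n | ∀ I : Finset (Fin n), I.card = d → ∃ i ∈ I, ∃ m : ℤ,
      z i = m + 1 / 2} ⊆ ⋃ J ∈ {J : Finset (Fin n) | J.card < d}, ⋃ w : Fin n → ℤ,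
        range fun u : J → ℝ => (WithLp.toLp 2 fun i =>
          if h : i ∈ J then u ⟨i, h⟩ else (w i : ℝ) + 1 / 2 : Euc n) := by
    classical
    intro z hz
    set J : Finset (Fin n) := Finset.univ.filter fun i => ¬ ∃ m : ℤ, z i = m + 1 / 2 with hJ
    have hJd : J.card < d := by
      by_contra! hcon
      obtain ⟨I, hIJ, hI⟩ := Finset.exists_subset_card_eq hcon
      obtain ⟨i, hi, hm⟩ := hz I hI
      exact (Finset.mem_filter.1 (hIJ hi)).2 hm
    have hw : ∀ i, ∃ m : ℤ, i ∉ J → z i = m + 1 / 2 := fun i => by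
      by_cases h : i ∈ J
      · exact ⟨0, fun h' => absurd h h'⟩
      · rw [hJ, Finset.mem_filter, not_and, not_not] at h
        obtain ⟨m, hm⟩ := h (Finset.mem_univ i)
        exact ⟨m, fun _ => hm⟩
    choose w hw using hw
    refine mem_iUnion₂.2 ⟨J, hJd, mem_iUnion.2 ⟨w, fun i => z i, ?_⟩⟩
    ext i
    by_cases h : i ∈ J
    · simp [h]
    · simp only [h, dite_false]
      exact (hw i h).symm
  refine measure_mono_null hsub ((measure_biUnion_null_iff (Set.to_countable _)).2 fun J hJ =>
    measure_iUnion_null fun w => ?_)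
  have hL : LipschitzWith (n : ℝ≥0) fun u : J → ℝ => (WithLp.toLp 2 fun i =>
      if h : i ∈ J then u ⟨i, h⟩ else (w i : ℝ) + 1 / 2 : Euc n) := by
    refine LipschitzWith.of_dist_le_mul fun u v => ?_
    rw [dist_eq_norm, dist_eq_norm, NNReal.coe_natCast]
    refine norm_le_card_mul fun i => ?_
    rw [PiLp.sub_apply]
    by_cases h : i ∈ J
    · simpa [h] using norm_le_pi_norm (u - v) ⟨i, h⟩
    · simp [h]
  have := hausdorffMeasure_of_dimH_lt (d := (d : ℝ≥0)) (hL.dimH_range_le.trans_lt (by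
    rw [Real.dimH_univ_pi, Fintype.card_coe]
    exact_mod_cast hJ))
  simpa using this

/-- The uniform probability measure on the unit cube. -/
def cubeProb (ι : Type*) [Fintype ι] : Measure (ι → ℝ) :=
  Measure.pi fun _ => volume.restrict (Ico (0 : ℝ) 1)

instance isProbabilityMeasure_Ico :
    IsProbabilityMeasure (volume.restrict (Ico (0 : ℝ) 1)) :=
  ⟨by simp⟩

instance isProbabilityMeasure_cubeProb (ι : Type*) [Fintype ι] :
    IsProbabilityMeasure (cubeProb ι) := by
  unfold cubeProb; infer_instance

lemma cubeProb_eq (ι : Type*) [Fintype ι] :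
    cubeProb ι = volume.restrict (univ.pi fun _ => Ico (0 : ℝ) 1) := by
  rw [volume_pi, Measure.restrict_pi_pi, cubeProb]

lemma ae_cubeProb_mem {ι : Type*} [Fintype ι] :
    ∀ᵐ a ∂cubeProb ι, ∀ i, a i ∈ Ico (0 : ℝ) 1 := by
  rw [cubeProb_eq]
  filter_upwards [ae_restrict_mem (MeasurableSet.univ_pi fun _ => measurableSet_Ico)] with a ha i
  exact ha i (mem_univ i)

lemma cubeProb_exists_sub_int_le {ι : Type*} [Fintype ι] {P : Set (ι → ℝ)}
    (hP : MeasurableSet P) :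
    cubeProb ι {a | ∃ x ∈ P, ∀ i, ∃ m : ℤ, x i - a i = m} ≤ volume P := by
  have hc : MeasurableSet (univ.pi fun _ : ι => Ico (0 : ℝ) 1) :=
    MeasurableSet.univ_pi fun _ => measurableSet_Ico
  have ht : ∀ z : ι → ℤ, MeasurableSet (univ.pi fun i : ι => Ico (z i : ℝ) (z i + 1)) :=
    fun z => MeasurableSet.univ_pi fun _ => measurableSet_Ico
  rw [cubeProb_eq, Measure.restrict_apply' hc]
  have hsub : {a : ι → ℝ | ∃ x ∈ P, ∀ i, ∃ m : ℤ, x i - a i = m} ∩ univ.pi (fun _ => Ico 0 1) ⊆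
      ⋃ z : ι → ℤ, (fun a => a + fun i => (z i : ℝ)) ⁻¹'
        (P ∩ univ.pi fun i : ι => Ico (z i : ℝ) (z i + 1)) := by
    rintro a ⟨⟨x, hx, hxa⟩, ha⟩
    choose z hz using hxa
    have e : (a + fun i => (z i : ℝ)) = x := by
      ext i; rw [Pi.add_apply]; linarith [hz i]
    refine mem_iUnion.2 ⟨z, ?_⟩
    rw [mem_preimage, e]
    refine ⟨hx, fun i _ => ?_⟩
    have := ha i (mem_univ i)
    constructor <;> linarith [hz i, this.1, this.2]
  refine (measure_mono hsub).trans ((measure_iUnion_le _).trans ?_)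
  simp only [measure_preimage_add_right]
  rw [← measure_iUnion (fun z w hzw => ?_) fun z => hP.inter (ht z)]
  · exact measure_mono (iUnion_subset fun z => inter_subset_left)
  · refine Set.disjoint_left.2 fun x hx hx' => hzw (funext fun i => ?_)
    have h1 := hx.2 i (mem_univ i)
    have h2 := hx'.2 i (mem_univ i)
    rw [← Int.floor_eq_iff.2 h1, ← Int.floor_eq_iff.2 h2]

lemma cubeProb_exists_sub_int_le_hausdorffMeasure {n : ℕ} {E : Set (Euc n)} (hE : IsCompact E)
    (I : Finset (Fin n)) :
    cubeProb (Fin n) {a | ∃ x ∈ E, ∀ i ∈ I, ∃ m : ℤ, x i - a i = m} ≤ μH[(I.card : ℝ)] E := by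
  set π : Euc n → (I → ℝ) := fun x i => x i
  have hL : LipschitzWith 1 π := LipschitzWith.of_dist_le_mul fun x y => by
    rw [NNReal.coe_one, one_mul, dist_pi_le_iff dist_nonneg]
    intro i
    rw [Real.dist_eq, dist_eq_norm]
    exact abs_sub_apply_le x y i
  have hP : MeasurableSet (π '' E) := (hE.image hL.continuous).measurableSet
  have h1 := cubeProb_exists_sub_int_le hP
  have h2 := hL.hausdorffMeasure_image_le (Nat.cast_nonneg I.card) E
  rw [ENNReal.coe_one, ENNReal.one_rpow, one_mul] at h2
  have h3 : volume (π '' E) = μH[(I.card : ℝ)] (π '' E) := by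
    rw [← hausdorffMeasure_pi_real, Fintype.card_coe]
  rw [← h3] at h2
  refine le_trans ?_ (h1.trans h2)
  have hmp := measurePreserving_piEquivPiSubtypeProd
    (fun _ : Fin n => volume.restrict (Ico (0 : ℝ) 1)) (fun i => i ∈ I)
  have hmap := (measurePreserving_fst.comp hmp)
  have := Measure.le_map_apply
    (μ := Measure.pi fun _ : Fin n => volume.restrict (Ico (0 : ℝ) 1))
    hmap.measurable.aemeasurable {a : {i // i ∈ I} → ℝ | ∃ x ∈ π '' E, ∀ i, ∃ m : ℤ, x i - a i = m}
  rw [hmap.map_eq] at this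
  refine le_trans (measure_mono ?_) (this.trans_eq (by rw [cubeProb]; congr!))
  rintro a ⟨x, hx, hxa⟩
  exact ⟨π x, mem_image_of_mem _ hx, fun i => hxa i i.2⟩

/-- The cost `cellDist t ^ (-α)`. -/
def poleCost (α t : ℝ) : ℝ≥0∞ := ENNReal.ofReal (cellDist t) ^ (-α)

lemma measurable_poleCost (α : ℝ) : Measurable (poleCost α) :=
  (continuous_cellDist.measurable.ennreal_ofReal).pow_const _

lemma one_le_poleCost {α : ℝ} (h0 : 0 ≤ α) (t : ℝ) : 1 ≤ poleCost α t := by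
  rw [poleCost, ENNReal.rpow_neg, ENNReal.one_le_inv]
  exact ENNReal.rpow_le_one (ENNReal.ofReal_le_one.2 (by linarith [cellDist_le t])) h0

lemma lintegral_Icc_rpow_neg_lt_top {α : ℝ} (hα : α < 1) :
    ∫⁻ s in Icc (0 : ℝ) (1 / 2), ENNReal.ofReal s ^ (-α) < ⊤ := by
  rw [setLIntegral_congr Ioc_ae_eq_Icc.symm]
  have h1 : IntegrableOn (fun s : ℝ => s ^ (-α)) (Ioc 0 (1 / 2)) :=
    (intervalIntegrable_iff_integrableOn_Ioc_of_le (by norm_num)).1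
      (intervalIntegral.intervalIntegrable_rpow' (by linarith))
  refine lt_of_eq_of_lt (setLIntegral_congr_fun measurableSet_Ioc fun s hs => ?_)
    h1.lintegral_lt_top
  exact ENNReal.ofReal_rpow_of_pos hs.1

lemma exists_lintegral_poleCost_le {α : ℝ} (hα : α < 1) :
    ∃ A : ℝ≥0∞, A ≠ ⊤ ∧ ∀ x : ℝ, ∫⁻ t in Ico (0 : ℝ) 1, poleCost α (x - t) ≤ A := by
  set J : ℝ → ℝ≥0∞ := (Icc (0 : ℝ) (1 / 2)).indicator fun s => ENNReal.ofReal s ^ (-α)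
  have hJm : Measurable J :=
    (ENNReal.measurable_ofReal.pow_const _).indicator measurableSet_Icc
  set A0 := ∫⁻ s in Icc (0 : ℝ) (1 / 2), ENNReal.ofReal s ^ (-α)
  have hA : A0 ≠ ⊤ := (lintegral_Icc_rpow_neg_lt_top hα).ne
  have hJA : ∫⁻ s, J s = A0 := lintegral_indicator measurableSet_Icc _
  have hJs : ∀ s, |s| ≤ 1 / 2 → ENNReal.ofReal |s| ^ (-α) ≤ J s + J (-s) := fun s hs => by
    rcases le_total 0 s with h | h
    · rw [abs_of_nonneg h] at hs ⊢
      have : J s = _ := indicator_of_mem (show s ∈ Icc (0 : ℝ) (1 / 2) from ⟨h, hs⟩) _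
      rw [this]
      exact le_self_add
    · rw [abs_of_nonpos h] at hs ⊢
      have : J (-s) = _ :=
        indicator_of_mem (show -s ∈ Icc (0 : ℝ) (1 / 2) from ⟨by linarith, hs⟩) _
      rw [this]
      exact le_add_self
  have h1 : ∀ c : ℝ, ∫⁻ t, J (c - t) = A0 := fun c => by
    rw [← hJA, lintegral_sub_left_eq_self]
  have h2 : ∀ c : ℝ, ∫⁻ t, J (-(c - t)) = A0 := fun c => by
    rw [← hJA, ← lintegral_sub_right_eq_self J c]
    simp only [neg_sub]
  refine ⟨A0 + A0 + (A0 + A0), by simp [hA], fun x => ?_⟩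
  calc ∫⁻ t in Ico (0 : ℝ) 1, poleCost α (x - t)
      ≤ ∫⁻ t in Ico (0 : ℝ) 1, (J (x - round x - t) + J (-(x - round x - t))
          + (J (x - round x + 1 - t) + J (-(x - round x + 1 - t)))) := by
        refine setLIntegral_mono' measurableSet_Ico fun t ht => ?_
        have r1 : round (x - t) ≤ round x := round_mono' (by linarith [ht.1])
        have r2 : round x - 1 ≤ round (x - t) := by
          rw [← round_sub_one]; exact round_mono' (by linarith [ht.2])
        have hr := abs_sub_round (x - t)
        have e : round (x - t) = round x ∨ round (x - t) = round x - 1 := by omega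
        rw [poleCost, cellDist]
        refine (hJs _ hr).trans ?_
        rcases e with e | e
        · rw [e, sub_right_comm]
          exact le_self_add
        · rw [e]
          refine le_trans (le_of_eq ?_) le_add_self
          push_cast
          congr 2 <;> ring
    _ ≤ ∫⁻ t, (J (x - round x - t) + J (-(x - round x - t))
          + (J (x - round x + 1 - t) + J (-(x - round x + 1 - t)))) := setLIntegral_le_lintegral _ _
    _ = A0 + A0 + (A0 + A0) := by
        rw [lintegral_add_left, lintegral_add_left, lintegral_add_left, h1, h1, h2, h2] <;>
        fun_prop

lemma exists_lintegral_prod_poleCost_le (n : ℕ) {α : ℝ} (hα : α < 1) :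
    ∃ A : ℝ≥0∞, A ≠ ⊤ ∧ ∀ x : Euc n,
      ∫⁻ a, ∏ i, poleCost α (x i - a i) ∂cubeProb (Fin n) ≤ A := by
  obtain ⟨A, hA, h⟩ := exists_lintegral_poleCost_le hα
  refine ⟨A ^ n, ENNReal.pow_ne_top hA, fun x => ?_⟩
  have hm : ∀ i, Measurable fun t : ℝ => poleCost α (x i - t) := fun i =>
    (measurable_poleCost α).comp (measurable_const.sub measurable_id)
  have hind : ProbabilityTheory.iIndepFun
      (fun (i : Fin n) (a : Fin n → ℝ) => poleCost α (x i - a i)) (cubeProb (Fin n)) :=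
    ProbabilityTheory.iIndepFun_pi (X := fun i t => poleCost α (x i - t))
      fun i => (hm i).aemeasurable
  rw [ProbabilityTheory.lintegral_prod_eq_prod_lintegral_of_indepFun _ _ hind
    fun i => (hm i).comp (measurable_pi_apply i)]
  refine (Finset.prod_le_pow_card _ _ A fun i _ => ?_).trans_eq (by simp)
  have hmp := measurePreserving_eval (fun _ : Fin n => volume.restrict (Ico (0 : ℝ) 1)) i
  have := hmp.lintegral_comp (hm i)
  exact this.le.trans (h (x i))

/-- A translation vector avoiding small bad sets with controlled cost. -/
lemma exists_translation {n d : ℕ} {α : ℝ} {A : ℝ≥0∞}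
    (hA : ∀ x : Euc n, ∫⁻ a, ∏ i, poleCost α (x i - a i) ∂cubeProb (Fin n) ≤ A)
    {E S : Set (Euc n)} (hE : IsCompact E) (hSE : S ⊆ E)
    (hc : 2 ^ (n + 1) * μH[(d : ℝ)] E ≤ 1) :
    ∃ a : Fin n → ℝ, (∀ i, a i ∈ Ico (0 : ℝ) 1) ∧
      (∀ x ∈ E, ∀ I : Finset (Fin n), I.card = d → ∃ i ∈ I, ∀ m : ℤ, x i - a i ≠ m) ∧
      ∫⁻ x in S, ∏ i, poleCost α (x i - a i) ∂μH[(d : ℝ)] ≤ 2 * A * μH[(d : ℝ)] S := by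
  set ν := cubeProb (Fin n)
  set bad : Set (Fin n → ℝ) := ⋃ I ∈ {I : Finset (Fin n) | I.card = d},
    {a | ∃ x ∈ E, ∀ i ∈ I, ∃ m : ℤ, x i - a i = m}
  have hEf : μH[(d : ℝ)] E < ⊤ := by
    refine lt_of_le_of_lt ?_ (hc.trans_lt ENNReal.one_lt_top)
    exact le_mul_of_one_le_left zero_le (one_le_pow₀ (by norm_num))
  have hb : ν bad ≤ 1 / 2 := by
    calc ν bad ≤ ∑ I : Finset (Fin n), μH[(d : ℝ)] E := by
          have : bad ⊆ ⋃ I : Finset (Fin n), if I.card = d then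
              {a | ∃ x ∈ E, ∀ i ∈ I, ∃ m : ℤ, x i - a i = m} else ∅ := by
            refine iUnion₂_subset fun I hI => ?_
            refine Subset.trans ?_ (subset_iUnion _ I)
            rw [if_pos (show I.card = d from hI)]
          refine (measure_mono this).trans ((measure_iUnion_fintype_le _ _).trans
            (Finset.sum_le_sum fun I _ => ?_))
          split_ifs with hI
          · rw [← hI]
            exact cubeProb_exists_sub_int_le_hausdorffMeasure hE I
          · simp
      _ = 2 ^ n * μH[(d : ℝ)] E := by simp
      _ ≤ 1 / 2 := by
          rw [ENNReal.le_div_iff_mul_le (by simp) (by simp)]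
          refine le_trans (le_of_eq ?_) hc
          rw [pow_succ]; ring
  have hb' : 1 / 2 ≤ ν badᶜ := by
    have h3 : 1 ≤ ν bad + ν badᶜ := by
      rw [← measure_univ (μ := ν), ← union_compl_self bad]
      exact measure_union_le _ _
    have h4 : (1 : ℝ≥0∞) = 1 / 2 + 1 / 2 := (ENNReal.add_halves 1).symm
    rw [h4] at h3
    exact (ENNReal.add_le_add_iff_left (by simp)).1 (h3.trans (add_le_add_left hb _))
  set G : (Fin n → ℝ) → ℝ≥0∞ := fun a =>
    ∫⁻ x in S, ∏ i, poleCost α (x i - a i) ∂μH[(d : ℝ)]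
  have : IsFiniteMeasure (μH[(d : ℝ)].restrict S) :=
    ⟨by rw [Measure.restrict_apply_univ]; exact (measure_mono hSE).trans_lt hEf⟩
  have hmeas : Measurable (Function.uncurry fun (a : Fin n → ℝ) (x : Euc n) =>
      ∏ i, poleCost α (x i - a i)) := by
    refine Finset.measurable_prod _ fun i _ => (measurable_poleCost α).comp ?_
    fun_prop
  have hGm : Measurable G := hmeas.lintegral_prod_right'
  have hGi : ∫⁻ a, G a ∂ν ≤ A * μH[(d : ℝ)] S := by
    rw [lintegral_lintegral_swap hmeas.aemeasurable]
    refine (lintegral_mono fun x => hA x).trans ?_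
    rw [lintegral_const, Measure.restrict_apply_univ]
  have hn0 : ν badᶜ ≠ 0 := fun h => by rw [h] at hb'; simp at hb'
  have hae : ∀ᵐ a ∂ν, ∀ i, a i ∈ Ico (0 : ℝ) 1 := ae_cubeProb_mem
  set good : Set (Fin n → ℝ) := badᶜ ∩ {a | ∀ i, a i ∈ Ico (0 : ℝ) 1}
  have hgν : ν good = ν badᶜ := measure_inter_conull hae
  obtain ⟨a, ha, hle⟩ := exists_le_setLAverage (s := good) (μ := ν) (f := G)
    (by rwa [hgν]) (measure_ne_top _ _) hGm.aemeasurable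
  refine ⟨a, ha.2, fun x hx I hI => ?_, hle.trans ?_⟩
  · by_contra! hcon
    exact ha.1 (mem_iUnion₂.2 ⟨I, hI, x, hx, hcon⟩)
  · rw [setLAverage_eq, hgν, ENNReal.div_le_iff hn0 (measure_ne_top _ _)]
    calc ∫⁻ a in good, G a ∂ν ≤ A * μH[(d : ℝ)] S := (setLIntegral_le_lintegral _ _).trans hGi
      _ = 2 * A * μH[(d : ℝ)] S * (1 / 2) := by
          have h5 : (2 : ℝ≥0∞) * (1 / 2) = 1 := ENNReal.mul_div_cancel (by simp) (by simp)
          rw [mul_right_comm 2 A, mul_right_comm (2 * _), mul_right_comm 2 _ (1 / 2), h5, one_mul,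
            mul_comm]
      _ ≤ _ := by gcongr

section lattice

variable {n d N : ℕ} {θ : ℝ} {x : Euc n}

lemma abs_latFlow_le (h0 : 0 < θ) (h1 : θ ≤ 1) (h : ∀ j, |x j| ≤ N + 1 / 2) (j : Fin n) :
    |latFlow d N θ x j| ≤ N + 1 / 2 := by
  by_cases hx : ∃ i, N + 1 / 4 ≤ |x i|
  · obtain ⟨i, hi⟩ := hx
    rw [latFlow_eq_self_of_le hi]
    exact h j
  push Not at hx
  have hj := abs_lt.1 (hx j)
  have hr := round_mem (x j)
  have h2 := abs_le.1 (abs_add_logDisp_sub_le (latScale_pos (d := d) (N := N) (x := x) h0 h1)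
    (latScale_le_one h1) (abs_sub_round (x j)))
  have c1 : round (x j) ≤ N := by
    have : (round (x j) : ℝ) < ((N + 1 : ℤ) : ℝ) := by push_cast; linarith
    exact Int.lt_add_one_iff.1 (Int.cast_lt.1 this)
  have c2 : -(N : ℤ) ≤ round (x j) := by
    have : ((-N - 1 : ℤ) : ℝ) < round (x j) := by push_cast; linarith
    have := Int.cast_lt.1 this
    omega
  have c1' : (round (x j) : ℝ) ≤ N := by exact_mod_cast c1
  have c2' : -(N : ℝ) ≤ round (x j) := by exact_mod_cast c2
  rw [latFlow_apply, abs_le]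
  constructor <;> linarith

/-- The points whose image under the flow stays near the walls or the dual skeleton. -/
def wallBad {n : ℕ} (d N : ℕ) : Set (Euc n) :=
  {y | (∃ I : Finset (Fin n), I.card = d ∧ n * cellSum I y < wallSum N y) ∨ ∃ j, N + 1 / 2 < |y j|}

lemma exists_le_cellDist_latFlow (hd : 1 ≤ d) (h0 : 0 < θ) (h1 : θ ≤ 1)
    (hθ : ∀ I : Finset (Fin n), I.card = d → θ ≤ cellSum I x) (hx : x ∉ wallBad d N)
    {I : Finset (Fin n)} (hI : I.card = d) :
    ∃ i ∈ I, 1 / (2 * (2 * (n + 2) * d)) ≤ cellDist (latFlow d N θ x i) := by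
  have hw : wallSum N x ≤ n * cellSum I x := by
    by_contra! hcon
    exact hx (Or.inl ⟨I, hI, hcon⟩)
  set σ := latScale d N θ x with hσ
  have hs0 : 0 < σ := latScale_pos h0 h1
  have hs1 : σ ≤ 1 := latScale_le_one h1
  have hσI : σ ≤ (n + 2) * cellSum I x := by
    have h2 := latMin_le (N := N) (x := x) hI
    have h3 := hθ I hI
    have h4 := mul_nonneg (latMin_nonneg (d := d) (N := N) (x := x)) h0.le
    rw [hσ, latScale]
    linarith
  have hd0 : (0 : ℝ) < d := by exact_mod_cast hd
  have hc : 0 < (n + 2) * (d : ℝ) := by positivity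
  have : ∃ i ∈ I, σ / ((n + 2) * d) ≤ logCoord (cellDist (x i)) := by
    have hne : I.Nonempty := Finset.card_pos.1 (by omega)
    by_contra! hcon
    have h5 : cellSum I x < ∑ i ∈ I, σ / ((n + 2) * d) := Finset.sum_lt_sum_of_nonempty hne hcon
    rw [Finset.sum_const, hI, nsmul_eq_mul] at h5
    have h6 : (d : ℝ) * (σ / ((n + 2) * d)) = σ / (n + 2) := by field_simp
    rw [h6, lt_div_iff₀ (by positivity)] at h5
    linarith
  obtain ⟨i, hi, hle⟩ := this
  refine ⟨i, hi, ?_⟩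
  have h7 : 1 / ((n + 2) * d) ≤ logCoord (cellDist (latFlow d N θ x i)) := by
    rw [latFlow_apply, logCoord_cellDist_add_logDisp hs0 hs1]
    refine le_min ?_ ?_
    · rw [div_le_one hc]
      have : (1 : ℝ) ≤ d := by exact_mod_cast hd
      have hn : (0 : ℝ) ≤ n := Nat.cast_nonneg n
      nlinarith
    · rw [div_le_div_iff₀ hc hs0]
      rw [div_le_iff₀ hc] at hle
      linarith
  have h8 := h7.trans (logCoord_le (cellDist_nonneg _))
  rw [div_le_iff₀ hc] at h8
  rw [div_le_iff₀ (by positivity)]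
  linarith

lemma exists_lt_abs_of_mem_wallBad (hx : x ∈ wallBad d N) : ∃ j, N < |x j| := by
  rcases hx with ⟨I, _, h⟩ | ⟨j, hj⟩
  · by_contra! hcon
    have : wallSum N x = 0 := Finset.sum_eq_zero fun j _ => wallCoord_of_le (hcon j)
    rw [this] at h
    exact absurd h (not_lt.2 (mul_nonneg (Nat.cast_nonneg n) cellSum_nonneg))
  · exact ⟨j, by linarith⟩

lemma one_div_latMin_rpow_le (hx : x ∈ wallBad d N) :
    0 < latMin d N x ∧ ENNReal.ofReal (1 / latMin d N x) ^ (d : ℝ)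
      ≤ ∏ i, poleCost (d / (d + 1)) (x i) := by
  have hα : (0 : ℝ) ≤ d / (d + 1) := by positivity
  have hd1 : (0 : ℝ) < d + 1 := by positivity
  by_cases h1 : ∃ j, wallCoord N (x j) = 1
  · obtain ⟨j, hj⟩ := h1
    have : latMin d N x = 1 := le_antisymm latMin_le_one (hj ▸ wallCoord_le_latMin j)
    rw [this]
    refine ⟨one_pos, ?_⟩
    simp only [div_one, ENNReal.ofReal_one, ENNReal.one_rpow]
    exact Finset.one_le_prod' fun i _ => one_le_poleCost hα _
  push Not at h1
  have hlt : ∀ j, |x j| < N + 1 / 4 := fun j => by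
    by_contra! hcon
    exact h1 j (wallCoord_of_ge hcon)
  rcases hx with ⟨I, hI, h⟩ | ⟨j, hj⟩
  swap
  · exact absurd (hlt j) (by linarith)
  have hn : 0 < n := by
    rcases Nat.eq_zero_or_pos n with rfl | hn
    · simp [wallSum] at h
    · exact hn
  have : Nonempty (Fin n) := ⟨⟨0, hn⟩⟩
  obtain ⟨j, -, hj⟩ := Finset.exists_max_image Finset.univ (fun j => wallCoord N (x j))
    Finset.univ_nonempty
  have hsum : wallSum N x ≤ n * wallCoord N (x j) :=
    (Finset.sum_le_card_nsmul _ _ _ hj).trans_eq (by simp)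
  have hb : cellSum I x < wallCoord N (x j) := by
    have : (0 : ℝ) < n := by exact_mod_cast hn
    exact lt_of_mul_lt_mul_left (h.trans_le hsum) this.le
  have hNj : N < |x j| := by
    by_contra! hcon
    rw [wallCoord_of_le hcon] at hb
    exact absurd hb (not_lt.2 cellSum_nonneg)
  obtain ⟨e1, e2⟩ := wallCoord_eq hNj (by linarith [hlt j])
  set D := cellDist (x j) with hD
  have hD0 : 0 < D := by rw [e2]; linarith
  have hDw : D ≤ latMin d N x := by
    refine le_trans ?_ (wallCoord_le_latMin j)
    rw [e1]
    have := le_logCoord hD0.le (lt_of_le_of_ne (logCoord_le_one D) (e1 ▸ h1 j))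
    linarith
  have hcell : ∀ i ∈ I, cellDist (x i) < D := fun i hi => by
    by_contra! hcon
    have h3 : logCoord (cellDist (x i)) ≤ cellSum I x :=
      Finset.single_le_sum (f := fun i => logCoord (cellDist (x i)))
        (fun _ _ => logCoord_nonneg (cellDist_nonneg _)) hi
    have h4 := logCoord_mono hcon
    rw [← e1] at h4
    linarith
  have hjI : j ∉ I := fun hj => lt_irrefl _ (hcell j hj)
  refine ⟨hD0.trans_le hDw, (ofReal_one_div_rpow_mono hD0 hDw (Nat.cast_nonneg d)).trans ?_⟩
  set a := ENNReal.ofReal D with ha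
  have ha0 : a ≠ 0 := by simpa [ha] using hD0
  calc ENNReal.ofReal (1 / D) ^ (d : ℝ) = (a ^ (-((d : ℝ) / (d + 1)))) ^ (d + 1) := by
        rw [← ENNReal.rpow_natCast, ← ENNReal.rpow_mul, one_div, ENNReal.ofReal_inv_of_pos hD0,
          ENNReal.inv_rpow, ← ENNReal.rpow_neg]
        congr 1
        push_cast
        field_simp
    _ = ∏ _i ∈ insert j I, a ^ (-((d : ℝ) / (d + 1))) := by
        rw [Finset.prod_const, Finset.card_insert_of_notMem hjI, hI]
    _ ≤ ∏ i ∈ insert j I, poleCost (d / (d + 1)) (x i) := by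
        refine Finset.prod_le_prod' fun i hi => ?_
        rw [poleCost, ENNReal.rpow_neg, ENNReal.rpow_neg, ENNReal.inv_le_inv]
        refine ENNReal.rpow_le_rpow (ENNReal.ofReal_le_ofReal ?_) hα
        rcases Finset.mem_insert.1 hi with rfl | hi
        · exact le_rfl
        · exact (hcell i hi).le
    _ ≤ ∏ i, poleCost (d / (d + 1)) (x i) :=
        Finset.prod_le_prod_of_subset_of_one_le' (Finset.subset_univ _)
          fun i _ _ => one_le_poleCost hα _

lemma continuous_latMin : Continuous (latMin d N : Euc n → ℝ) := by
  have : LipschitzWith (16 * n) (latMin d N : Euc n → ℝ) :=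
    LipschitzWith.of_dist_le_mul fun x y => by
      rw [Real.dist_eq, dist_eq_norm]
      exact_mod_cast abs_latMin_sub_le
  exact this.continuous

lemma continuous_logCoord : Continuous logCoord := by
  refine Continuous.div (by fun_prop) (by fun_prop) fun a => ?_
  linarith [half_le_max a]

lemma continuous_cellSum (I : Finset (Fin n)) : Continuous (cellSum I) :=
  continuous_finsetSum _ fun i _ =>
    continuous_logCoord.comp (continuous_cellDist.comp (by fun_prop))

lemma continuous_wallSum : Continuous (wallSum N : Euc n → ℝ) :=
  continuous_finsetSum _ fun i _ => continuous_logCoord.comp (by fun_prop)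

lemma isOpen_wallBad : IsOpen (wallBad d N : Set (Euc n)) := by
  have e : (wallBad d N : Set (Euc n)) =
      (⋃ I ∈ {I : Finset (Fin n) | I.card = d}, {y | n * cellSum I y < wallSum N y})
        ∪ ⋃ j, {y | N + 1 / 2 < |y j|} := by
    ext y
    simp [wallBad]
  rw [e]
  refine (isOpen_biUnion fun I _ => ?_).union (isOpen_iUnion fun j => ?_)
  · exact isOpen_lt (continuous_const.mul (continuous_cellSum I)) continuous_wallSum
  · exact isOpen_lt continuous_const (by fun_prop)

lemma cellSum_pos {I : Finset (Fin n)} (h : ∃ i ∈ I, ∀ m : ℤ, x i ≠ m) : 0 < cellSum I x := by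
  obtain ⟨i, hi, hm⟩ := h
  have h0 : 0 < cellDist (x i) := by
    refine lt_of_le_of_ne (cellDist_nonneg _) fun h => ?_
    obtain ⟨m, hm'⟩ := cellDist_eq_zero_iff.1 h.symm
    exact hm m hm'
  have h1 : 0 < logCoord (cellDist (x i)) :=
    div_pos (by linarith) (by linarith [half_le_max (cellDist (x i))])
  exact h1.trans_le (Finset.single_le_sum (f := fun i => logCoord (cellDist (x i)))
        (fun _ _ => logCoord_nonneg (cellDist_nonneg _)) hi)

lemma exists_le_cellSum {E : Set (Euc n)} (hE : IsCompact E)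
    (h : ∀ x ∈ E, ∀ I : Finset (Fin n), I.card = d → ∃ i ∈ I, ∀ m : ℤ, x i ≠ m) :
    ∃ θ > 0, ∀ x ∈ E, ∀ I : Finset (Fin n), I.card = d → θ ≤ cellSum I x := by
  have key : ∀ᶠ θ in 𝓝[>] (0 : ℝ), ∀ I : Finset (Fin n), I.card = d → ∀ x ∈ E,
      θ ≤ cellSum I x := by
    refine eventually_all.2 fun I => ?_
    by_cases hI : I.card = d
    · obtain ⟨δ, hδ, hle⟩ := hE.exists_forall_le' (continuous_cellSum I).continuousOn
        fun x hx => cellSum_pos (h x hx I hI)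
      filter_upwards [Ioc_mem_nhdsGT hδ] with θ hθ _ x hx
      exact hθ.2.trans (hle x hx)
    · exact Eventually.of_forall fun θ h => absurd h hI
  obtain ⟨θ, h1, h2⟩ := (key.and self_mem_nhdsWithin).exists
  exact ⟨θ, h2, fun x hx I hI => h1 I hI x hx⟩

end lattice

/-- The deformation lemma at unit scale. -/
lemma exists_deformation (n d : ℕ) (hd : 1 ≤ d) :
    ∃ C1 : ℝ≥0∞, C1 ≠ ⊤ ∧ ∀ (N : ℕ) (E : Set (Euc n)), IsCompact E →
      2 ^ (n + 1) * μH[(d : ℝ)] E ≤ 1 → ∀ (c : Euc n) (ρ r : ℝ), ρ < r →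
      (∀ x : Euc n, (∀ j, |x j| ≤ N + 4) → dist x c ≤ ρ) →
      ∃ φ ∈ DeformClass c r, (∀ x : Euc n, (∃ j, N + 4 ≤ |x j|) → φ x = x) ∧
        μH[(d : ℝ)] (φ '' E) ≤ C1 * μH[(d : ℝ)] (E ∩ {x | ∃ j, N - 1 < |x j|}) := by
  have hd0 : (0 : ℝ) < d := by exact_mod_cast hd
  have hd1 : (1 : ℝ) ≤ d := by exact_mod_cast hd
  obtain ⟨A, hA, hAint⟩ := exists_lintegral_prod_poleCost_le n (α := d / (d + 1))
    (by rw [div_lt_one (by positivity)]; linarith)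
  set lam : ℝ := 2 * (n + 2) * d with hlam
  have hl : 1 ≤ lam := by
    have : (0 : ℝ) ≤ n := Nat.cast_nonneg n
    nlinarith
  set K : ℝ≥0 := (1 + Real.toNNReal (n + lam + 1)) ^ (List.finRange n).length with hK
  set C : ℝ := K * (1 + n * (16 * n + 4)) with hC
  have hC0 : 0 ≤ C := by positivity
  refine ⟨ENNReal.ofReal (2 * C) ^ (d : ℝ) * (2 * A),
    ENNReal.mul_ne_top (ENNReal.rpow_ne_top_of_nonneg hd0.le ENNReal.ofReal_ne_top)
      (ENNReal.mul_ne_top (by simp) hA), ?_⟩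
  intro N E hE hsmall c ρ r hρ hcρ
  set S : Set (Euc n) := E ∩ {x | ∃ j, N - 1 < |x j|}
  obtain ⟨a, ha, havoid, hcost⟩ := exists_translation hAint hE (inter_subset_left : S ⊆ E) hsmall
  set p : Euc n := WithLp.toLp 2 a with hp
  have hpa : ∀ (x : Euc n) j, (x - p) j = x j - a j := fun x j => rfl
  obtain ⟨θ, hθ, hθle⟩ := exists_le_cellSum (d := d) (E := (fun x => x - p) '' E)
    (hE.image (by fun_prop)) (by
      rintro _ ⟨x, hx, rfl⟩ I hI
      exact havoid x hx I hI)
  have hcρ' : ∀ x : Euc n, (∀ j, |x j| ≤ N + 2) → dist x (c - p) ≤ ρ := fun x hx => by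
    have := hcρ (x + p) fun j => by
      have h1 := abs_le.1 (hx j)
      have h2 := ha j
      rw [PiLp.add_apply, abs_le]
      change -((N : ℝ) + 4) ≤ x j + a j ∧ x j + a j ≤ N + 4
      constructor <;> linarith [h2.1, h2.2]
    rwa [← dist_add_right x (c - p) p, sub_add_cancel]
  obtain ⟨τ, hτ0, hτθ, hτ1, hF⟩ := exists_latFlow_mem_deformClass d N hθ hρ
    fun x hx => hcρ' x fun j => (hx j).trans (by linarith)
  have hCol : collapse N lam (List.finRange n) ∈ DeformClass (c - p) r :=
    collapse_mem_deformClass hl hρ hcρ' _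
  set ψ : Euc n → Euc n := collapse N lam (List.finRange n) ∘ latFlow d N τ with hψ
  have hψm : ψ ∈ DeformClass (c - p) r := DeformClass.comp hCol hF
  set φ : Euc n → Euc n := fun x => p + ψ (x - p) with hφ
  have hφm : φ ∈ DeformClass c r := by
    have := DeformClass.homothety hψm p one_pos
    simpa using this
  refine ⟨φ, hφm, ?_, ?_⟩
  · rintro x ⟨j, hj⟩
    have hj' : N + 2 ≤ |(x - p) j| := by
      rw [hpa]
      have h2 := ha j
      have h3 := abs_sub_abs_le_abs_sub (x j) (a j)
      rw [abs_of_nonneg h2.1] at h3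
      linarith [h2.2]
    rw [hφ]
    change p + collapse _ _ _ (latFlow _ _ _ _) = x
    rw [latFlow_eq_self_of_le (j := j) (by linarith), collapse_eq_self hl hj']
    abel
  · set B : Set (Euc n) := E ∩ (fun x => x - p) ⁻¹' wallBad d N
    have hBm : MeasurableSet B :=
      hE.measurableSet.inter (isOpen_wallBad.preimage (by fun_prop)).measurableSet
    have hBS : B ⊆ S := by
      rintro x ⟨hx, hxb⟩
      obtain ⟨j, hj⟩ := exists_lt_abs_of_mem_wallBad hxb
      refine ⟨hx, j, ?_⟩
      have h2 := ha j
      have h3 := abs_sub (x j) (a j)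
      rw [abs_of_nonneg h2.1] at h3
      change (N : ℝ) < |x j - a j| at hj
      linarith [h2.2]
    have hgood : μH[(d : ℝ)] (φ '' (E \ B)) = 0 := by
      have hsub : φ '' (E \ B) ⊆ (fun z => p + z) '' {z : Euc n | ∀ I : Finset (Fin n),
          I.card = d → ∃ i ∈ I, ∃ m : ℤ, z i = m + 1 / 2} := by
        rintro _ ⟨x, hx, rfl⟩
        have hxb : x - p ∉ wallBad d N := fun h => hx.2 ⟨hx.1, h⟩
        refine ⟨ψ (x - p), fun I hI => ?_, rfl⟩
        obtain ⟨i, hi, hle⟩ := exists_le_cellDist_latFlow hd hτ0 hτ1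
          (fun I hI => hτθ.trans (hθle _ (mem_image_of_mem _ hx.1) I hI)) hxb hI
        refine ⟨i, hi, (exists_collapse_apply_eq hl (abs_latFlow_le hτ0 hτ1 fun j => ?_) hle
          (List.finRange n)).2 (List.mem_finRange i)⟩
        by_contra! hcon
        exact hxb (Or.inr ⟨j, hcon⟩)
      refine measure_mono_null hsub ?_
      have hLp : LipschitzWith 1 (fun z : Euc n => p + z) :=
        LipschitzWith.of_dist_le_mul fun x y => by simp [dist_add_left]
      have := hLp.hausdorffMeasure_image_le hd0.le
        {z : Euc n | ∀ I : Finset (Fin n), I.card = d → ∃ i ∈ I, ∃ m : ℤ, z i = m + 1 / 2}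
      rw [hausdorffMeasure_halfLattice_eq_zero, mul_zero] at this
      exact le_antisymm this bot_le
    have hbad : μH[(d : ℝ)] (φ '' B) ≤ ENNReal.ofReal (2 * C) ^ (d : ℝ) *
        ∫⁻ x in B, ENNReal.ofReal (1 / latScale d N τ (x - p)) ^ (d : ℝ) ∂μH[(d : ℝ)] := by
      refine hausdorffMeasure_image_le_lintegral hC0 hd0.le hBm ?_
        (fun x _ => latScale_pos hτ0 hτ1) (fun x _ => latScale_le_one hτ1) fun x _ y _ => ?_
      · have : Continuous (latScale d N τ : Euc n → ℝ) := by
          have := continuous_latMin (n := n) (d := d) (N := N)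
          unfold latScale
          fun_prop
        exact (this.comp (by fun_prop : Continuous fun x : Euc n => x - p)).measurable
      · rw [hφ]
        change dist (p + collapse _ _ _ (latFlow _ _ _ _))
          (p + collapse _ _ _ (latFlow _ _ _ _)) ≤ _
        rw [dist_add_left]
        refine ((collapse_lipschitz hl _).dist_le_mul _ _).trans ?_
        have := mul_le_mul_of_nonneg_left
          (dist_latFlow_le (d := d) (N := N) (x := x - p) (y := y - p) hτ0 hτ1) K.coe_nonneg
        refine this.trans_eq ?_
        rw [dist_sub_right, hC]
        ring
    calc μH[(d : ℝ)] (φ '' E) ≤ μH[(d : ℝ)] (φ '' B) + μH[(d : ℝ)] (φ '' (E \ B)) := by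
          have e : φ '' E = φ '' B ∪ φ '' (E \ B) := by
            rw [← image_union, union_sdiff_cancel (inter_subset_left : B ⊆ E)]
          rw [e]
          exact measure_union_le _ _
      _ ≤ ENNReal.ofReal (2 * C) ^ (d : ℝ) * ∫⁻ x in S, ∏ i, poleCost (d / (d + 1)) (x i - a i)
            ∂μH[(d : ℝ)] := by
          rw [hgood, add_zero]
          refine hbad.trans (mul_le_mul_right ?_ _)
          refine le_trans (setLIntegral_mono' hBm fun x hx => ?_) (lintegral_mono_set hBS)
          obtain ⟨h1, h2⟩ := one_div_latMin_rpow_le hx.2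
          exact (ofReal_one_div_rpow_mono h1 (latMin_le_latScale hτ0.le) hd0.le).trans h2
      _ ≤ _ := by
          rw [mul_assoc]
          exact mul_le_mul_right hcost _

section WeakStar

variable {n : ℕ} {U S V : Set (Euc n)}

lemma exists_bump (hS : IsCompact S) (hV : IsOpen V) (hSV : S ⊆ V) :
    ∃ f : Euc n → ℝ, Continuous f ∧ HasCompactSupport f ∧ tsupport f ⊆ V ∧
      ∀ ν : Measure (Euc n), IsLocallyFiniteMeasure ν →
        ν S ≤ ENNReal.ofReal (∫ z, f z ∂ν) ∧ ENNReal.ofReal (∫ z, f z ∂ν) ≤ ν V := by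
  obtain ⟨k, hk, hSk, hkV⟩ := exists_compact_between hS hV hSV
  obtain ⟨f, f1, f0, fc, fI⟩ := exists_continuous_one_zero_of_isCompact hS
    (isOpen_interior (s := k)).isClosed_compl (disjoint_compl_right_iff_subset.2 hSk)
  refine ⟨f, f.continuous, fc, ?_, fun ν hν => ?_⟩
  · refine (closure_minimal (fun x hx => ?_) hk.isClosed).trans hkV
    by_contra h
    exact hx (f0 fun h' => h (interior_subset h'))
  · rw [ofReal_integral_eq_lintegral_ofReal
      (f.continuous.integrable_of_hasCompactSupport fc) (Eventually.of_forall fun x => (fI x).1),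
      ← lintegral_indicator_one hS.measurableSet, ← lintegral_indicator_one hV.measurableSet]
    refine ⟨lintegral_mono fun x => ?_, lintegral_mono fun x => ?_⟩
    · by_cases h : x ∈ S
      · simp [h, f1 h]
      · simp [h]
    · by_cases h : x ∈ V
      · simpa [h] using (fI x).2
      · have : f x = 0 := f0 fun h' => h (hkV (interior_subset h'))
        simp [this]

variable {μs : ℕ → Measure (Euc n)} {μ : Measure (Euc n)}

lemma WeakStarOn.eventually_measure_lt (h : WeakStarOn U μs μ) (hμ : IsLocallyFiniteMeasure μ)
    (hμs : ∀ᶠ j in atTop, IsFiniteMeasure (μs j)) (hS : IsCompact S) (hV : IsOpen V)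
    (hSV : S ⊆ V) (hVU : V ⊆ U) {a : ℝ≥0∞} (ha : μ V < a) : ∀ᶠ j in atTop, μs j S < a := by
  obtain ⟨f, f1, f2, f3, f4⟩ := exists_bump hS hV hSV
  filter_upwards [hμs, (ENNReal.tendsto_ofReal (h f f1 f2 (f3.trans hVU))).eventually_lt_const
    ((f4 μ hμ).2.trans_lt ha)] with j hj hlt
  exact (f4 _ inferInstance).1.trans_lt hlt

lemma WeakStarOn.eventually_lt_measure (h : WeakStarOn U μs μ) (hμ : IsLocallyFiniteMeasure μ)
    (hμs : ∀ᶠ j in atTop, IsFiniteMeasure (μs j)) (hS : IsCompact S) (hV : IsOpen V)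
    (hSV : S ⊆ V) (hVU : V ⊆ U) {a : ℝ≥0∞} (ha : a < μ S) : ∀ᶠ j in atTop, a < μs j V := by
  obtain ⟨f, f1, f2, f3, f4⟩ := exists_bump hS hV hSV
  filter_upwards [hμs, (ENNReal.tendsto_ofReal (h f f1 f2 (f3.trans hVU))).eventually_const_lt
    (ha.trans_le (f4 μ hμ).1)] with j hj hlt
  exact hlt.trans_le (f4 _ inferInstance).2

end WeakStar

section SupDist

variable {n : ℕ}

/-- The sup-norm distance on `ℝ^n`. -/
def supDist (p x : Euc n) : ℝ := ‖WithLp.ofLp (x - p)‖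

lemma continuous_supDist (p : Euc n) : Continuous (supDist p) := by
  unfold supDist
  fun_prop

lemma dist_le_mul_supDist (p x : Euc n) : dist x p ≤ n * supDist p x := by
  rw [dist_eq_norm]
  exact norm_le_card_mul fun i => norm_le_pi_norm (WithLp.ofLp (x - p)) i

lemma supDist_le_dist (p x : Euc n) : supDist p x ≤ dist x p := by
  rw [dist_eq_norm]
  exact (pi_norm_le_iff_of_nonneg (norm_nonneg _)).2 fun i => PiLp.norm_apply_le (x - p) i

lemma isCompact_supDist_le (p : Euc n) (s : ℝ) : IsCompact {x | supDist p x ≤ s} := by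
  refine isCompact_of_isClosed_isBounded (isClosed_le (continuous_supDist p) continuous_const)
    (isBounded_closedBall (x := p) (r := n * s) |>.subset fun x hx => ?_)
  exact (dist_le_mul_supDist p x).trans (mul_le_mul_of_nonneg_left hx (Nat.cast_nonneg n))

lemma supDist_smul (p x : Euc n) {ε : ℝ} (hε : 0 < ε) :
    ‖WithLp.ofLp (ε⁻¹ • (x - p))‖ = ε⁻¹ * supDist p x := by
  rw [WithLp.ofLp_smul, norm_smul, Real.norm_of_nonneg (inv_nonneg.2 hε.le)]
  rfl

end SupDist

open scoped Pointwise in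
lemma hausdorffMeasure_homothety_image {n d : ℕ} (p q : Euc n) {ε : ℝ} (hε : 0 < ε)
    (A : Set (Euc n)) :
    μH[(d : ℝ)] ((fun x => q + ε • (x - p)) '' A) = ENNReal.ofReal ε ^ d * μH[(d : ℝ)] A := by
  have h1 : (fun x => q + ε • (x - p)) '' A
      = (IsometryEquiv.addLeft q) '' (ε • ((IsometryEquiv.subRight p) '' A)) := by
    rw [← image_smul, image_image, image_image]
    rfl
  rw [h1, IsometryEquiv.hausdorffMeasure_image, Measure.hausdorffMeasure_smul₀ d.cast_nonneg hε.ne',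
    IsometryEquiv.hausdorffMeasure_image, ENNReal.smul_def, smul_eq_mul, NNReal.rpow_natCast,
    ENNReal.coe_pow, ENNReal.ofReal, Real.toNNReal_eq_nnnorm_of_nonneg hε.le]

/-- Rescaled deformation onto a skeleton of a cubical grid of mesh `ε`. -/
lemma exists_deformation_supDist (n d : ℕ) (hd : 1 ≤ d) :
    ∃ C1 : ℝ≥0∞, C1 ≠ ⊤ ∧ ∀ (p : Euc n) (ε : ℝ), 0 < ε → ∀ (N : ℕ) (E : Set (Euc n)),
      IsCompact E → 2 ^ (n + 1) * μH[(d : ℝ)] E ≤ ENNReal.ofReal ε ^ d →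
      ∀ (c : Euc n) (ρ r : ℝ), ρ < r → (∀ x, supDist p x ≤ ε * (N + 4) → dist x c ≤ ρ) →
      ∃ φ ∈ DeformClass c r, (∀ x, ε * (N + 4) < supDist p x → φ x = x) ∧
        μH[(d : ℝ)] (φ '' E) ≤ C1 * μH[(d : ℝ)] (E ∩ {x | ε * (N - 1) < supDist p x}) := by
  obtain ⟨C1, hC1, H⟩ := exists_deformation n d hd
  refine ⟨C1, hC1, fun p ε hε N E hE hsmall c ρ r hρ hc => ?_⟩
  have hε' : 0 < ε⁻¹ := inv_pos.2 hε
  have hcancel : ENNReal.ofReal ε ^ d * ENNReal.ofReal ε⁻¹ ^ d = 1 := by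
    rw [← mul_pow, ← ENNReal.ofReal_mul hε.le, mul_inv_cancel₀ hε.ne', ENNReal.ofReal_one, one_pow]
  obtain ⟨T, hT⟩ : ∃ T : Euc n → Euc n, T = fun x => 0 + ε⁻¹ • (x - p) := ⟨_, rfl⟩
  have hTc : Continuous T := by
    rw [hT]
    fun_prop
  have hTm : ∀ A, μH[(d : ℝ)] (T '' A) = ENNReal.ofReal ε⁻¹ ^ d * μH[(d : ℝ)] A := by
    intro A
    have := hausdorffMeasure_homothety_image (d := d) p 0 hε' A
    rw [hT, this]
  have hTnorm : ∀ x, ‖WithLp.ofLp (T x)‖ = ε⁻¹ * supDist p x := fun x => by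
    simpa [hT] using supDist_smul p x hε
  have hTinv : ∀ y, T (p + ε • y) = y := fun y => by simp [hT, smul_smul, hε.ne']
  have hsmall' : 2 ^ (n + 1) * μH[(d : ℝ)] (T '' E) ≤ 1 := by
    rw [hTm, mul_left_comm]
    calc _ ≤ ENNReal.ofReal ε⁻¹ ^ d * ENNReal.ofReal ε ^ d := mul_le_mul_right hsmall _
      _ = 1 := by rw [mul_comm, hcancel]
  obtain ⟨φ, hφ, hφ1, hφ2⟩ := H N (T '' E) (hE.image hTc) hsmall' (T c) (ε⁻¹ * ρ) (ε⁻¹ * r)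
    (mul_lt_mul_of_pos_left hρ hε') fun y hy => by
      have h1 : ‖WithLp.ofLp (T (p + ε • y))‖ ≤ N + 4 := by
        rw [hTinv]
        exact (pi_norm_le_iff_of_nonneg (by positivity)).2 hy
      rw [hTnorm, inv_mul_le_iff₀ hε] at h1
      have h2 := hc _ h1
      rw [← hTinv y]
      simp only [hT]
      rw [dist_add_left, dist_smul₀, dist_sub_right, Real.norm_of_nonneg hε'.le]
      exact mul_le_mul_of_nonneg_left h2 hε'.le
  have hcr : p + ε • T c = c ∧ ε * (ε⁻¹ * r) = r := by
    constructor
    · simp [hT, smul_smul, hε.ne']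
    · field_simp
  have hmem := DeformClass.homothety hφ p hε
  rw [hcr.1, hcr.2] at hmem
  refine ⟨_, hmem, fun x hx => ?_, ?_⟩
  · have : φ (ε⁻¹ • (x - p)) = ε⁻¹ • (x - p) := by
      refine hφ1 _ ?_
      by_contra! hcon
      have h1 : ‖WithLp.ofLp (ε⁻¹ • (x - p))‖ ≤ N + 4 :=
        (pi_norm_le_iff_of_nonneg (by positivity)).2 fun j => (hcon j).le
      rw [supDist_smul p x hε, inv_mul_le_iff₀ hε] at h1
      exact hx.not_ge h1
    change p + ε • φ (ε⁻¹ • (x - p)) = x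
    rw [this, smul_inv_smul₀ hε.ne']
    abel
  · have e1 : (fun x => p + ε • φ (ε⁻¹ • (x - p))) '' E
        = (fun y => p + ε • (y - 0)) '' (φ '' (T '' E)) := by
      rw [image_image, image_image]
      simp [hT]
    have e2 : T '' E ∩ {x | ∃ j, (N : ℝ) - 1 < |x j|}
        ⊆ T '' (E ∩ {x | ε * (N - 1) < supDist p x}) := by
      rintro _ ⟨⟨x, hx, rfl⟩, j, hj⟩
      refine ⟨x, ⟨hx, ?_⟩, rfl⟩
      have h1 : (N : ℝ) - 1 < ε⁻¹ * supDist p x := by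
        rw [← hTnorm]
        exact hj.trans_le (norm_le_pi_norm (WithLp.ofLp (T x)) j)
      rwa [lt_inv_mul_iff₀ hε] at h1
    rw [e1, hausdorffMeasure_homothety_image 0 p hε]
    calc _ ≤ ENNReal.ofReal ε ^ d *
          (C1 * (ENNReal.ofReal ε⁻¹ ^ d *
            μH[(d : ℝ)] (E ∩ {x | ε * (N - 1) < supDist p x}))) := by
          refine mul_le_mul_right (hφ2.trans (mul_le_mul_right ?_ _)) _
          rw [← hTm]
          exact measure_mono e2
      _ = _ := by
          rw [mul_left_comm, ← mul_assoc (ENNReal.ofReal ε ^ d), hcancel, one_mul]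

lemma plateauInf_le_competInf {n d : ℕ} {P : Set (Set (Euc n))} {K : Set (Euc n)} {y : Euc n}
    {r : ℝ} : plateauInf d P ≤ competInf d P K y r := by
  refine le_sInf ?_
  rintro m ⟨J, hJ, -, rfl⟩
  exact iInf₂_le J hJ

/-- Comparison of an element of a good class with its image under a cubical deformation. -/
lemma exists_plateauInf_le (n d : ℕ) (hd : 1 ≤ d) :
    ∃ C1 : ℝ≥0∞, C1 ≠ ⊤ ∧ ∀ (H : Set (Euc n)) (P : Set (Set (Euc n))), IsGoodClass d H P →
      ∀ K ∈ P, RelClosedIn Hᶜ K → ∀ y ∈ K, ∀ (ρ : ℝ), 0 ≤ ρ →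
      ENNReal.ofReal ρ < infEDist y H → ∀ (p : Euc n) (ε : ℝ), 0 < ε → ∀ N : ℕ,
      (∀ x, supDist p x ≤ ε * (N + 4) → dist x y ≤ ρ) →
      2 ^ (n + 1) * μH[(d : ℝ)] (K ∩ {x | supDist p x ≤ ε * (N + 4)}) ≤ ENNReal.ofReal ε ^ d →
      plateauInf d P ≤ μH[(d : ℝ)] (K \ {x | supDist p x ≤ ε * (N + 4)}) +
        C1 * μH[(d : ℝ)] (K ∩ {x | supDist p x ≤ ε * (N + 4)} ∩
          {x | ε * (N - 1) < supDist p x}) := by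
  obtain ⟨C1, hC1, hdef⟩ := exists_deformation_supDist n d hd
  refine ⟨C1, hC1, fun H P hP K hK hKc y hy ρ hρ hρH p ε hε N hQ hsmall => ?_⟩
  set Q := {x | supDist p x ≤ ε * (N + 4)}
  obtain ⟨-, F, hF, rfl⟩ := hKc
  have hQH : Q ⊆ Hᶜ := fun x hx hxH => by
    have h1 : infEDist y H ≤ ENNReal.ofReal ρ := by
      refine (infEDist_le_edist_of_mem hxH).trans ?_
      rw [edist_comm, edist_dist]
      exact ENNReal.ofReal_le_ofReal (hQ x hx)
    exact h1.not_gt hρH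
  have hE : IsCompact (F ∩ Hᶜ ∩ Q) := by
    have : F ∩ Hᶜ ∩ Q = Q ∩ F := by
      ext x
      exact ⟨fun h => ⟨h.2, h.1.1⟩, fun h => ⟨⟨h.2, hQH h.1⟩, h.1⟩⟩
    rw [this]
    exact (isCompact_supDist_le p _).inter_right hF
  obtain ⟨R, -, hR1, hR2⟩ := ENNReal.lt_iff_exists_real_btwn.1 hρH
  have hρR : ρ < R := (ENNReal.ofReal_lt_ofReal_iff_of_nonneg hρ).1 hR1
  have hae := hP _ hK y hy
  obtain ⟨r, hr, hgood⟩ : ∃ r ∈ Ioo ρ R, (0 < r ∧ ENNReal.ofReal r < infEDist y H) →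
      ∀ φ ∈ DeformClass y r, competInf d P (F ∩ Hᶜ) y r ≤ μH[(d : ℝ)] (φ '' (F ∩ Hᶜ)) := by
    by_contra! hcon
    have h0 : volume (Ioo ρ R) = 0 := by
      refine measure_mono_null (fun r hr => ?_) (ae_iff.1 hae)
      obtain ⟨h1, φ, h2, h3⟩ := hcon r hr
      exact fun h => (h h1 φ h2).not_gt h3
    rw [Real.volume_Ioo, ENNReal.ofReal_eq_zero] at h0
    linarith
  obtain ⟨φ, hφ, hφ1, hφ2⟩ := hdef p ε hε N _ hE hsmall y ρ r hr.1 hQ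
  have h1 := hgood ⟨hρ.trans_lt hr.1,
    (ENNReal.ofReal_le_ofReal hr.2.le).trans_lt hR2⟩ φ hφ
  refine (plateauInf_le_competInf.trans h1).trans ?_
  refine le_trans (measure_mono (?_ : _ ⊆ ((F ∩ Hᶜ) \ Q) ∪ φ '' (F ∩ Hᶜ ∩ Q)))
    ((measure_union_le _ _).trans (add_le_add le_rfl hφ2))
  rintro _ ⟨x, hx, rfl⟩
  by_cases hxQ : x ∈ Q
  · exact Or.inr ⟨x, ⟨hx, hxQ⟩, rfl⟩
  · rw [hφ1 x (not_le.1 hxQ)]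
    exact Or.inl ⟨hx, hxQ⟩

/-- Hole-filling inequality for weak-* limits of minimizing sequences on concentric cubes. -/
lemma exists_measure_supDist_le (n d : ℕ) (hd : 1 ≤ d) :
    ∃ C1 : ℝ≥0∞, C1 ≠ ⊤ ∧ ∀ (H : Set (Euc n)) (P : Set (Set (Euc n))),
      (∀ K ∈ P, RelClosedIn Hᶜ K) → IsGoodClass d H P → plateauInf d P ≠ ⊤ →
      ∀ Kj : ℕ → Set (Euc n), IsMinimizingSeq d P Kj →
      ∀ μ : Measure (Euc n), IsLocallyFiniteMeasure μ →
        WeakStarOn Hᶜ (fun j => μH[(d : ℝ)].restrict (Kj j)) μ →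
      ∀ x ∈ sptMeas μ, ∀ r : ℝ, 0 ≤ r → ENNReal.ofReal r < infEDist x H →
      ∀ ε : ℝ, 0 < ε → ∀ N : ℕ, (∀ z, supDist x z ≤ ε * (N + 5) → dist z x ≤ r) →
      2 ^ (n + 1) * μ {z | supDist x z ≤ ε * (N + 5)} < ENNReal.ofReal ε ^ d →
      μ {z | supDist x z ≤ ε * (N - 2)} ≤
        C1 * μ {z | ε * (N - 2) < supDist x z ∧ supDist x z < ε * (N + 5)} := by
  obtain ⟨C1, hC1, hcomp⟩ := exists_plateauInf_le n d hd
  refine ⟨C1, hC1, fun H P hPc hP hfin Kj hKj μ hμ hw x hx r hr hrH ε hε N hQ hsmall => ?_⟩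
  have hcs := continuous_supDist x
  have hQH : {z | supDist x z ≤ ε * (N + 5)} ⊆ Hᶜ := fun z hz hzH => by
    have h1 : infEDist x H ≤ ENNReal.ofReal r := by
      refine (infEDist_le_edist_of_mem hzH).trans ?_
      rw [edist_comm, edist_dist]
      exact ENNReal.ofReal_le_ofReal (hQ z hz)
    exact h1.not_gt hrH
  -- the total masses are eventually finite
  have hνfin : ∀ᶠ j in atTop, IsFiniteMeasure (μH[(d : ℝ)].restrict (Kj j)) := by
    filter_upwards [hKj.2.2.eventually_lt_const hfin.lt_top] with j hj
    exact ⟨by rwa [Measure.restrict_apply_univ]⟩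
  obtain ⟨R, hR0, hR1, hR2⟩ := ENNReal.lt_iff_exists_real_btwn.1 hrH
  have hrR : r < R := (ENNReal.ofReal_lt_ofReal_iff_of_nonneg hr).1 hR1
  -- centres in `Kj`
  set η := min ((R - r) / 2) (ε * 5) with hη
  have hη0 : 0 < η := lt_min (by linarith) (by linarith)
  have hηR : η ≤ (R - r) / 2 := min_le_left _ _
  have hcent : ∀ᶠ j in atTop, 0 < μH[(d : ℝ)].restrict (Kj j) (ball x η) := by
    refine hw.eventually_lt_measure hμ hνfin (isCompact_closedBall x (η / 2)) isOpen_ball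
      (closedBall_subset_ball (by linarith)) (fun z hz => hQH ?_)
      ((hx _ (half_pos hη0)).trans_le (measure_mono ball_subset_closedBall))
    have h1 : dist z x < η := hz
    have h2 : η ≤ ε * 5 := min_le_right _ _
    have h3 : 0 ≤ ε * N := by positivity
    have := supDist_le_dist x z
    change supDist x z ≤ _
    linarith
  have hsm : ∀ᶠ j in atTop, μH[(d : ℝ)].restrict (Kj j) {z | supDist x z ≤ ε * (N + 4)}
      < ENNReal.ofReal ε ^ d / 2 ^ (n + 1) := by
    refine hw.eventually_measure_lt hμ hνfin (isCompact_supDist_le x _)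
      (V := {z | supDist x z < ε * (N + 5)}) (isOpen_lt hcs continuous_const)
      (fun z hz => lt_of_le_of_lt hz (mul_lt_mul_of_pos_left (by linarith) hε))
      (fun z hz => hQH (le_of_lt hz : supDist x z ≤ _)) ?_
    rw [ENNReal.lt_div_iff_mul_lt (by simp) (by simp), mul_comm]
    have h1 : {z | supDist x z < ε * (N + 5)} ⊆ {z | supDist x z ≤ ε * (N + 5)} :=
      fun z hz => (le_of_lt hz : supDist x z ≤ _)
    exact (mul_le_mul_right (measure_mono h1) _).trans_lt hsmall
  set V := {z | ε * (N - 2) < supDist x z ∧ supDist x z < ε * (N + 5)}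
  have hVfin : μ V ≠ ⊤ := ne_top_of_le_ne_top (isCompact_supDist_le x (ε * (N + 5))).measure_ne_top
    (measure_mono fun z hz => le_of_lt hz.2)
  refine le_of_forall_lt_imp_le_of_dense fun a ha => ?_
  have hlim : Tendsto (fun k : ℕ => C1 * (μ V + (k : ℝ≥0∞)⁻¹) + (k : ℝ≥0∞)⁻¹) atTop
      (𝓝 (C1 * (μ V + 0) + 0)) :=
    (ENNReal.Tendsto.const_mul (ENNReal.tendsto_inv_nat_nhds_zero.const_add _)
      (Or.inr hC1)).add ENNReal.tendsto_inv_nat_nhds_zero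
  rw [add_zero, add_zero] at hlim
  refine ge_of_tendsto' hlim fun k => ?_
  set δ := (k : ℝ≥0∞)⁻¹ with hδ
  have hδ0 : δ ≠ 0 := ENNReal.inv_ne_zero.2 (ENNReal.natCast_ne_top k)
  have hin : ∀ᶠ j in atTop, a < μH[(d : ℝ)].restrict (Kj j) {z | supDist x z < ε * (N - 1)} :=
    hw.eventually_lt_measure hμ hνfin (isCompact_supDist_le x _) (isOpen_lt hcs continuous_const)
      (fun z hz => lt_of_le_of_lt hz (mul_lt_mul_of_pos_left (by linarith) hε))
      (fun z hz => hQH ((le_of_lt hz).trans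
        (mul_le_mul_of_nonneg_left (by linarith) hε.le) : supDist x z ≤ _)) ha
  have hsh : ∀ᶠ j in atTop, μH[(d : ℝ)].restrict (Kj j)
      ({z | supDist x z ≤ ε * (N + 4)} ∩ {z | ε * (N - 1) ≤ supDist x z}) < μ V + δ :=
    hw.eventually_measure_lt hμ hνfin
      ((isCompact_supDist_le x _).inter_right (isClosed_le continuous_const hcs))
      ((isOpen_lt continuous_const hcs).inter (isOpen_lt hcs continuous_const))
      (fun z hz => ⟨lt_of_lt_of_le (mul_lt_mul_of_pos_left (by linarith) hε) hz.2,
        lt_of_le_of_lt hz.1 (mul_lt_mul_of_pos_left (by linarith) hε)⟩)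
      (fun z hz => hQH (le_of_lt hz.2 : supDist x z ≤ _)) (ENNReal.lt_add_right hVfin hδ0)
  have hmass := hKj.2.2.eventually_lt_const (ENNReal.lt_add_right hfin hδ0)
  obtain ⟨j, j1, j2, j3, j4, j5, j6⟩ :=
    (hνfin.and (hcent.and (hsm.and (hin.and (hsh.and hmass))))).exists
  obtain ⟨y, hyball, hyK⟩ : (ball x η ∩ Kj j).Nonempty := by
    rw [Measure.restrict_apply measurableSet_ball] at j2
    exact nonempty_of_measure_ne_zero j2.ne'
  have hyx : dist y x < η := hyball
  have hyH : ENNReal.ofReal (r + η) < infEDist y H := by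
    by_contra! hcon
    have h1 : infEDist x H ≤ ENNReal.ofReal R := by
      calc infEDist x H ≤ infEDist y H + edist x y := infEDist_le_infEDist_add_edist
        _ ≤ ENNReal.ofReal (r + η) + ENNReal.ofReal η := by
            refine add_le_add hcon ?_
            rw [edist_comm, edist_dist]
            exact ENNReal.ofReal_le_ofReal hyx.le
        _ = ENNReal.ofReal (r + η + η) := (ENNReal.ofReal_add (by linarith) hη0.le).symm
        _ ≤ _ := ENNReal.ofReal_le_ofReal (by linarith)
    exact h1.not_gt hR2
  set Q := {z | supDist x z ≤ ε * (N + 4)}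
  have hQm : MeasurableSet Q := (isCompact_supDist_le x _).measurableSet
  set S := {z | ε * (N - 1) < supDist x z}
  have hSm : MeasurableSet S := (isOpen_lt continuous_const hcs).measurableSet
  set κ := μH[(d : ℝ)].restrict (Kj j) with hκ
  have hmain := hcomp H P hP _ (hKj.1 j) (hPc _ (hKj.1 j)) y hyK (r + η) (by linarith) hyH x ε hε N
    (fun z hz => by
      have h1 := hQ z (hz.trans (mul_le_mul_of_nonneg_left (by linarith) hε.le))
      have h2 := dist_triangle_right z y x
      linarith)
    (by
      rw [Measure.restrict_apply hQm, inter_comm, ENNReal.lt_div_iff_mul_lt (by simp) (by simp),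
        mul_comm] at j3
      exact j3.le)
  have e1 : μH[(d : ℝ)] (Kj j \ Q) = κ Qᶜ := by
    rw [hκ, Measure.restrict_apply hQm.compl, inter_comm, Set.sdiff_eq]
  have e2 : μH[(d : ℝ)] (Kj j ∩ Q ∩ S) = κ (Q ∩ S) := by
    rw [hκ, Measure.restrict_apply (hQm.inter hSm), inter_comm (Q ∩ S), inter_assoc]
  have e3 : μH[(d : ℝ)] (Kj j) = κ Qᶜ + κ Q := by
    rw [add_comm, measure_add_measure_compl hQm, hκ, Measure.restrict_apply_univ]
  rw [e1, e2] at hmain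
  rw [e3] at j6
  have hκQ : κ Q ≤ C1 * κ (Q ∩ S) + δ := by
    have h1 : κ Qᶜ + κ Q ≤ κ Qᶜ + (C1 * κ (Q ∩ S) + δ) := by
      rw [← add_assoc]
      exact j6.le.trans (add_le_add hmain le_rfl)
    exact (ENNReal.add_le_add_iff_left (measure_ne_top κ _)).1 h1
  calc a ≤ κ {z | supDist x z < ε * (N - 1)} := j4.le
    _ ≤ κ Q := measure_mono fun z hz =>
        (le_of_lt hz).trans (mul_le_mul_of_nonneg_left (by linarith) hε.le)
    _ ≤ C1 * κ (Q ∩ S) + δ := hκQ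
    _ ≤ C1 * (μ V + δ) + δ := by
        refine add_le_add (mul_le_mul_right (le_trans (measure_mono ?_) j5.le) _) le_rfl
        exact fun z hz => ⟨hz.1, (le_of_lt hz.2 : ε * (N - 1) ≤ supDist x z)⟩

/-- Iteration of a geometric decay estimate on shrinking concentric cubes. -/
lemma mul_half_eq_zero_of_decay {d : ℕ} (hd : 1 ≤ d) {m : ℝ → ℝ≥0∞} (hm : Monotone m)
    {A : ℝ≥0∞} {q s : ℝ} (hq0 : 0 < q) (hq1 : q < 1) (hs : 0 < s)
    (hstep : ∀ t ≤ s, ∀ ε, 0 < ε → 5 * ε ≤ t → A * m t < ENNReal.ofReal ε ^ d →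
      m (t - 8 * ε) ≤ ENNReal.ofReal q ^ d * m t)
    (h0 : A * m s < ENNReal.ofReal (s * (1 - q) / 16) ^ d) : A * m (s / 2) = 0 := by
  set ε := s * (1 - q) / 16 with hε
  have hε0 : 0 < ε := by
    have : 0 < 1 - q := by linarith
    positivity
  have key : ∀ k : ℕ, A * m (s / 2 * (1 + q ^ k)) < ENNReal.ofReal (ε * q ^ k) ^ d := by
    intro k
    induction k with
    | zero =>
      convert h0 using 3
      · norm_num
      · rw [pow_zero, mul_one]
    | succ k ih =>
      have hqk : 0 < q ^ k := pow_pos hq0 k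
      have hqk1 : q ^ k ≤ 1 := pow_le_one₀ hq0.le hq1.le
      have h1 := hstep (s / 2 * (1 + q ^ k)) (by nlinarith) (ε * q ^ k) (by positivity)
        (by rw [hε]; nlinarith [mul_pos hs hqk, mul_pos (mul_pos hs hqk) hq0]) ih
      have e1 : s / 2 * (1 + q ^ k) - 8 * (ε * q ^ k) = s / 2 * (1 + q ^ (k + 1)) := by
        rw [hε]
        ring
      rw [e1] at h1
      have hqd : ENNReal.ofReal q ^ d ≠ 0 := pow_ne_zero _ (by simpa using hq0)
      have hqd' : ENNReal.ofReal q ^ d ≠ ⊤ := ENNReal.pow_ne_top ENNReal.ofReal_ne_top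
      calc A * m (s / 2 * (1 + q ^ (k + 1)))
          ≤ A * (ENNReal.ofReal q ^ d * m (s / 2 * (1 + q ^ k))) := mul_le_mul_right h1 _
        _ = ENNReal.ofReal q ^ d * (A * m (s / 2 * (1 + q ^ k))) := mul_left_comm _ _ _
        _ < ENNReal.ofReal q ^ d * ENNReal.ofReal (ε * q ^ k) ^ d :=
            (ENNReal.mul_lt_mul_iff_right hqd hqd').2 ih
        _ = ENNReal.ofReal (ε * q ^ (k + 1)) ^ d := by
            rw [← mul_pow, ← ENNReal.ofReal_mul hq0.le]
            ring_nf
  have hlim : Tendsto (fun k : ℕ => ENNReal.ofReal (ε * q ^ k) ^ d) atTop (𝓝 0) := by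
    have h1 : Tendsto (fun k : ℕ => ε * q ^ k) atTop (𝓝 (ε * 0)) :=
      (tendsto_pow_atTop_nhds_zero_of_lt_one hq0.le hq1).const_mul ε
    have h2 := (ENNReal.continuous_pow d).tendsto _ |>.comp (ENNReal.tendsto_ofReal h1)
    simpa [Function.comp_def, (Nat.one_le_iff_ne_zero.1 hd)] using h2
  refine le_antisymm (ge_of_tendsto' hlim fun k => ?_) bot_le
  refine (mul_le_mul_right (hm ?_) _).trans (key k).le
  have : 0 < q ^ k := pow_pos hq0 k
  nlinarith

/-- Mass decay for weak-* limits of minimizing sequences on concentric cubes. -/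
lemma exists_measure_supDist_decay (n d : ℕ) (hd : 1 ≤ d) :
    ∃ q : ℝ, 0 < q ∧ q < 1 ∧ ∀ (H : Set (Euc n)) (P : Set (Set (Euc n))),
      (∀ K ∈ P, RelClosedIn Hᶜ K) → IsGoodClass d H P → plateauInf d P ≠ ⊤ →
      ∀ Kj : ℕ → Set (Euc n), IsMinimizingSeq d P Kj →
      ∀ μ : Measure (Euc n), IsLocallyFiniteMeasure μ →
        WeakStarOn Hᶜ (fun j => μH[(d : ℝ)].restrict (Kj j)) μ →
      ∀ x ∈ sptMeas μ, ∀ r : ℝ, 0 ≤ r → ENNReal.ofReal r < infEDist x H →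
      ∀ t : ℝ, (∀ z, supDist x z ≤ t → dist z x ≤ r) → ∀ ε : ℝ, 0 < ε → 5 * ε ≤ t →
      2 ^ (n + 1) * μ {z | supDist x z ≤ t} < ENNReal.ofReal ε ^ d →
      μ {z | supDist x z ≤ t - 8 * ε} ≤ ENNReal.ofReal q ^ d * μ {z | supDist x z ≤ t} := by
  obtain ⟨C1, hC1, hhole⟩ := exists_measure_supDist_le n d hd
  have hd1 : (1 : ℝ) ≤ d := by exact_mod_cast hd
  set c := C1.toReal + 1 with hc
  have hc1 : 1 ≤ c := by linarith [C1.toReal_nonneg]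
  have hCc : C1 ≤ ENNReal.ofReal c := by
    rw [← ENNReal.ofReal_toReal hC1]
    exact ENNReal.ofReal_le_ofReal (by linarith)
  have hlt : 1 / ((1 + c) * d) < 1 := by
    rw [div_lt_one (by positivity)]
    nlinarith
  have hpos : 0 < 1 / ((1 + c) * d) := by positivity
  set q := 1 - 1 / ((1 + c) * d) with hq
  have hqd : c ≤ q ^ d * (1 + c) := by
    have h1 := one_add_mul_le_pow (a := -(1 / ((1 + c) * d))) (by linarith) d
    rw [← sub_eq_add_neg, ← hq] at h1
    have h2 : 1 + (d : ℝ) * -(1 / ((1 + c) * d)) = c / (1 + c) := by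
      field_simp
      ring
    rw [h2, div_le_iff₀ (by linarith)] at h1
    exact h1
  have hq0 : 0 < q := by rw [hq]; linarith
  refine ⟨q, hq0, by rw [hq]; linarith, fun H P hPc hP hfin Kj hKj μ hμ hw x hx r hr hrH t ht ε hε
    hεt hsmall => ?_⟩
  have h5 : 5 ≤ t / ε := by rwa [le_div_iff₀ hε]
  have hfl : 5 ≤ ⌊t / ε⌋₊ := Nat.le_floor (by exact_mod_cast h5)
  obtain ⟨N, hN⟩ := Nat.exists_eq_add_of_le' hfl
  have hN1 : (N : ℝ) + 5 ≤ t / ε := by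
    have := Nat.floor_le (show 0 ≤ t / ε by linarith)
    rw [hN] at this
    exact_mod_cast this
  have hN2 : t / ε < N + 6 := by
    have := Nat.lt_floor_add_one (t / ε)
    rw [hN] at this
    push_cast at this
    linarith
  rw [le_div_iff₀ hε, mul_comm] at hN1
  rw [div_lt_iff₀ hε, mul_comm] at hN2
  have hsub : {z | supDist x z ≤ ε * (N + 5)} ⊆ {z | supDist x z ≤ t} :=
    fun z hz => le_trans (show supDist x z ≤ _ from hz) hN1
  have h1 := hhole H P hPc hP hfin Kj hKj μ hμ hw x hx r hr hrH ε hε N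
    (fun z hz => ht z (hz.trans hN1)) ((mul_le_mul_right (measure_mono hsub) _).trans_lt hsmall)
  set I := {z | supDist x z ≤ ε * (N - 2)}
  set V := {z | ε * (N - 2) < supDist x z ∧ supDist x z < ε * (N + 5)}
  have hIV : μ I + μ V ≤ μ {z | supDist x z ≤ t} := by
    have hdisj : Disjoint I V := disjoint_left.2 fun z hz hz' => not_lt.2 hz hz'.1
    rw [← measure_union' hdisj (isCompact_supDist_le x _).measurableSet]
    refine measure_mono (union_subset (fun z hz => ?_) fun z hz => hsub (le_of_lt hz.2))
    exact hsub (le_trans (show supDist x z ≤ _ from hz)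
      (mul_le_mul_of_nonneg_left (by linarith) hε.le))
  have hC0 : (1 + ENNReal.ofReal c) ≠ 0 := by simp
  have hCt : (1 + ENNReal.ofReal c) ≠ ⊤ := by simp
  have h2 : (1 + ENNReal.ofReal c) * μ I ≤
      (1 + ENNReal.ofReal c) * (ENNReal.ofReal q ^ d * μ {z | supDist x z ≤ t}) := by
    calc (1 + ENNReal.ofReal c) * μ I = μ I + ENNReal.ofReal c * μ I := by ring
      _ ≤ ENNReal.ofReal c * μ V + ENNReal.ofReal c * μ I :=
          add_le_add (h1.trans (mul_le_mul_left hCc _)) le_rfl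
      _ = ENNReal.ofReal c * (μ I + μ V) := by ring
      _ ≤ ENNReal.ofReal (q ^ d * (1 + c)) * μ {z | supDist x z ≤ t} :=
          mul_le_mul' (ENNReal.ofReal_le_ofReal hqd) hIV
      _ = _ := by
          rw [ENNReal.ofReal_mul (by positivity), ENNReal.ofReal_pow hq0.le,
            ENNReal.ofReal_add zero_le_one (by linarith), ENNReal.ofReal_one]
          ring
  refine le_trans (measure_mono fun z hz => ?_) ((ENNReal.mul_le_mul_iff_right hC0 hCt).1 h2)
  refine le_trans (show supDist x z ≤ _ from hz) ?_
  linarith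

/-- **Step one of Theorem 1 (density lower bound).** There is a constant
`θ₀ = θ₀(n,d) > 0` such that any weak-* limit `μ` of `H^d ⌐ K_j` along a minimizing
sequence of a good class satisfies `μ(B(x,r)) ≥ θ₀ ω_d r^d` for every `x ∈ spt μ` and
every `r < dist(x,H)`. -/
theorem statement7 (n d : ℕ) (hd1 : 1 ≤ d) (hdn : d ≤ n) :
    ∃ θ0 : ℝ≥0∞, 0 < θ0 ∧
      ∀ (H : Set (Euc n)), IsClosed H →
      ∀ P : Set (Set (Euc n)), (∀ K ∈ P, RelClosedIn Hᶜ K ∧ CountablyRectifiable d K) →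
        IsGoodClass d H P → plateauInf d P ≠ ⊤ →
      ∀ Kj : ℕ → Set (Euc n), IsMinimizingSeq d P Kj →
      ∀ μ : Measure (Euc n), IsLocallyFiniteMeasure μ →
        WeakStarOn Hᶜ (fun j => μH[(d : ℝ)].restrict (Kj j)) μ →
      ∀ x ∈ sptMeas μ, ∀ r : ℝ, 0 < r → ENNReal.ofReal r < EMetric.infEdist x H →
        θ0 * ballVol d * ENNReal.ofReal r ^ d ≤ μ (ball x r) := by
  obtain ⟨q, hq0, hq1, hdecay⟩ := exists_measure_supDist_decay n d hd1
  set κ : ℝ := (1 - q) / (16 * (n + 1)) with hκ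
  have hκ0 : 0 < κ := by
    have : 0 < 1 - q := by linarith
    positivity
  have hω0 : ballVol d ≠ 0 := (measure_ball_pos _ _ one_pos).ne'
  have hωt : ballVol d ≠ ⊤ := measure_ball_lt_top.ne
  have hA0 : (2 : ℝ≥0∞) ^ (n + 1) ≠ 0 := by simp
  have hAt : (2 : ℝ≥0∞) ^ (n + 1) ≠ ⊤ := by simp
  refine ⟨ENNReal.ofReal κ ^ d / 2 ^ (n + 1) / ballVol d, ?_, ?_⟩
  · refine ENNReal.div_pos (ENNReal.div_pos (pow_ne_zero _ ?_) hAt).ne' hωt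
    simpa using hκ0
  intro H _ P hPc hP hfin Kj hKj μ hμ hw x hx r hr hrH
  rw [ENNReal.div_mul_cancel hω0 hωt]
  set s : ℝ := r / (n + 1) with hs
  have hs0 : 0 < s := by positivity
  have hball : ∀ z, supDist x z ≤ s → dist z x < r := fun z hz => by
    refine (dist_le_mul_supDist x z).trans_lt ?_
    calc n * supDist x z ≤ n * s := mul_le_mul_of_nonneg_left hz (Nat.cast_nonneg n)
      _ < (n + 1) * s := by linarith
      _ = r := by rw [hs]; field_simp
  by_contra! hcon
  set m : ℝ → ℝ≥0∞ := fun t => μ {z | supDist x z ≤ t}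
  have hmono : Monotone m := fun t t' htt' => measure_mono fun z hz =>
    le_trans (show supDist x z ≤ t from hz) htt'
  have hzero := mul_half_eq_zero_of_decay hd1 hmono (A := 2 ^ (n + 1)) hq0 hq1 hs0
    (fun t ht ε hε hεt hsm => hdecay H P (fun K hK => (hPc K hK).1) hP hfin Kj hKj μ hμ hw x hx r
      hr.le hrH t (fun z hz => (hball z (hz.trans ht)).le) ε hε hεt hsm) ?_
  · have h1 : m (s / 2) = 0 := (mul_eq_zero.1 hzero).resolve_left hA0
    refine (hx (s / 2) (by positivity)).ne' (measure_mono_null (fun z hz => ?_) h1)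
    exact (supDist_le_dist x z).trans (le_of_lt hz)
  · have h1 : m s ≤ μ (ball x r) := measure_mono fun z hz => hball z hz
    have e : s * (1 - q) / 16 = κ * r := by
      rw [hs, hκ]
      field_simp
    rw [e, ENNReal.ofReal_mul hκ0.le, mul_pow]
    have h2 := h1.trans_lt hcon
    rw [mul_comm, ← ENNReal.lt_div_iff_mul_lt (Or.inl hA0) (Or.inl hAt)]
    refine h2.trans_eq ?_
    simp only [div_eq_mul_inv]
    ring
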